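/- Let Γ be a finitely generated nilpotent group and let n ≥ 1. Set X = Hom(Γ, GL_n(ℂ)) with the topology of pointwise convergence, and let A ⊆ X be the subspace of those homomorphisms ρ such that ρ(γ) is a unitary matrix for every γ ∈ Γ. Then there is a strong deformation retraction H : X × [0,1] → X of X onto A which is U(n)-equivariant for the conjugation action, i.e. H(u·ρ(·)·u⁻¹, t) = u·H(ρ, t)(·)·u⁻¹ for every unitary u ∈ U(n), every ρ ∈ X and every t ∈ [0,1]. -/

import Mathlib

open Matrix

/-- The representation space `Hom(Γ, GL_n ℂ)`, realized as the subspace of the product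
space `Γ → Matrix (Fin n) (Fin n) ℂ` (with the topology of pointwise convergence)
consisting of the maps that are group homomorphisms into the invertible matrices. -/
abbrev RepGL (Γ : Type) [Group Γ] (n : ℕ) : Type :=
  {f : Γ → Matrix (Fin n) (Fin n) ℂ //
    f 1 = 1 ∧ (∀ γ₁ γ₂, f (γ₁ * γ₂) = f γ₁ * f γ₂) ∧ (∀ γ, IsUnit (f γ))}

set_option linter.unusedSectionVars false

section Frobenius

variable {m ι : Type*} [Fintype m] [DecidableEq m] [Fintype ι]

/-- The real Frobenius inner product of two complex matrices. -/
noncomputable def frobInner (A B : Matrix m m ℂ) : ℝ := (trace (Aᴴ * B)).re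

/-- The square of the Frobenius norm of a complex matrix. -/
noncomputable def frobSq (A : Matrix m m ℂ) : ℝ := frobInner A A

/-- The total squared Frobenius norm of a tuple of matrices. -/
noncomputable def energy (B : ι → Matrix m m ℂ) : ℝ := ∑ i, frobSq (B i)

/-- The moment map `∑ᵢ [Bᵢ, Bᵢᴴ]` of the conjugation action on tuples of matrices. -/
noncomputable def moment (B : ι → Matrix m m ℂ) : Matrix m m ℂ :=
  ∑ i, (B i * (B i)ᴴ - (B i)ᴴ * B i)

/-- Simultaneous conjugation of a tuple of matrices. -/
noncomputable def conjTuple (g : Matrix m m ℂ) (B : ι → Matrix m m ℂ) : ι → Matrix m m ℂ :=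
  fun i => g * B i * g⁻¹

theorem frobSq_eq_sum (A : Matrix m m ℂ) : frobSq A = ∑ k, ∑ j, ‖A k j‖ ^ 2 := by
  simp only [frobSq, frobInner, trace, diag_apply, mul_apply, conjTranspose_apply, Complex.re_sum]
  rw [Finset.sum_comm]
  refine Finset.sum_congr rfl fun k _ => Finset.sum_congr rfl fun j _ => ?_
  rw [← Complex.normSq_eq_norm_sq, Complex.star_def, ← Complex.normSq_eq_conj_mul_self]
  simp

theorem frobSq_nonneg (A : Matrix m m ℂ) : 0 ≤ frobSq A := by
  rw [frobSq_eq_sum]; positivity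

theorem norm_entry_sq_le_frobSq (A : Matrix m m ℂ) (k j : m) : ‖A k j‖ ^ 2 ≤ frobSq A := by
  rw [frobSq_eq_sum]
  exact (Finset.single_le_sum (f := fun j => ‖A k j‖ ^ 2) (fun _ _ => by positivity)
    (Finset.mem_univ j)).trans
    (Finset.single_le_sum (f := fun k => ∑ j, ‖A k j‖ ^ 2) (fun _ _ => by positivity)
      (Finset.mem_univ k))

theorem frobSq_eq_zero_iff {A : Matrix m m ℂ} : frobSq A = 0 ↔ A = 0 := by
  refine ⟨fun h => ?_, fun h => by simp [h, frobSq, frobInner]⟩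
  ext k j
  have := norm_entry_sq_le_frobSq A k j
  rw [h] at this
  simpa using pow_eq_zero_iff two_ne_zero |>.1 (le_antisymm this (by positivity))

theorem frobInner_comm (A B : Matrix m m ℂ) : frobInner A B = frobInner B A := by
  rw [frobInner, frobInner, ← Complex.conj_re, ← Complex.star_def, ← trace_conjTranspose,
    conjTranspose_mul, conjTranspose_conjTranspose]

theorem frobInner_add_right (A B C : Matrix m m ℂ) :
    frobInner A (B + C) = frobInner A B + frobInner A C := by
  simp [frobInner, mul_add]

theorem frobInner_add_left (A B C : Matrix m m ℂ) :
    frobInner (A + B) C = frobInner A C + frobInner B C := by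
  simp [frobInner, add_mul]

theorem frobInner_smul_right (r : ℝ) (A B : Matrix m m ℂ) :
    frobInner A (r • B) = r * frobInner A B := by
  simp [frobInner]

theorem frobInner_sum_right (A : Matrix m m ℂ) (B : ι → Matrix m m ℂ) :
    frobInner A (∑ i, B i) = ∑ i, frobInner A (B i) := by
  simp [frobInner, Finset.mul_sum, trace_sum]

theorem frobSq_add (A B : Matrix m m ℂ) :
    frobSq (A + B) = frobSq A + 2 * frobInner A B + frobSq B := by
  simp only [frobSq, frobInner_add_left, frobInner_add_right, frobInner_comm B A]
  ring

theorem energy_nonneg (B : ι → Matrix m m ℂ) : 0 ≤ energy B :=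
  Finset.sum_nonneg fun _ _ => frobSq_nonneg _

theorem moment_conjTranspose (B : ι → Matrix m m ℂ) : (moment B)ᴴ = moment B := by
  simp [moment, conjTranspose_sum, conjTranspose_sub, conjTranspose_mul]

theorem frobInner_moment (W : Matrix m m ℂ) (hW : Wᴴ = W) (B : ι → Matrix m m ℂ) :
    frobInner W (moment B) = ∑ i, frobInner (B i) (W * B i - B i * W) := by
  rw [moment, frobInner_sum_right]
  refine Finset.sum_congr rfl fun i _ => ?_
  simp only [frobInner, hW, mul_sub, trace_sub]
  rw [← trace_mul_comm (W * B i) (B i)ᴴ, mul_assoc, ← mul_assoc (B i)ᴴ (B i) W,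
    trace_mul_comm _ W]

theorem frobInner_moment_deriv (v M : Matrix m m ℂ) (hM : Mᴴ = M)
    (C : Matrix m m ℂ) :
    frobInner M (v * Cᴴ + C * vᴴ - vᴴ * C - Cᴴ * v) = 2 * frobInner (M * C - C * M) v := by
  have e1 : frobInner M (v * Cᴴ - Cᴴ * v) = frobInner (M * C - C * M) v := by
    simp only [frobInner, hM, conjTranspose_sub, conjTranspose_mul, sub_mul, mul_sub, trace_sub]
    rw [← mul_assoc, trace_mul_cycle M v, mul_assoc M Cᴴ v]
  have e2 : frobInner M (C * vᴴ - vᴴ * C) = frobInner (M * C - C * M) v := by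
    rw [frobInner_comm (M * C - C * M)]
    simp only [frobInner, hM, mul_sub, trace_sub]
    rw [← mul_assoc, trace_mul_cycle M C, mul_assoc vᴴ, trace_mul_comm M (vᴴ * C), mul_assoc vᴴ C M]
  rw [show v * Cᴴ + C * vᴴ - vᴴ * C - Cᴴ * v = (v * Cᴴ - Cᴴ * v) + (C * vᴴ - vᴴ * C) by abel,
    frobInner_add_right, e1, e2]
  ring

section Norm

attribute [local instance] Matrix.frobeniusNormedRing Matrix.frobeniusNormedAlgebra

theorem frobSq_eq_norm_sq (A : Matrix m m ℂ) : frobSq A = ‖A‖ ^ 2 := by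
  rw [frobSq_eq_sum]
  change _ = ‖(show Matrix m m ℂ from A)‖ ^ 2
  have h := frobenius_norm_def A
  have : ‖A‖ = Real.sqrt (∑ k, ∑ j, ‖A k j‖ ^ 2) := by
    rw [Real.sqrt_eq_rpow]
    convert h using 3
    norm_cast
  rw [this, Real.sq_sqrt (by positivity)]

theorem norm_conjTranspose_frob (A : Matrix m m ℂ) : ‖Aᴴ‖ = ‖A‖ :=
  frobenius_norm_conjTranspose A

theorem frobInner_le_norm (A B : Matrix m m ℂ) : frobInner A B ≤ ‖A‖ * ‖B‖ := by
  have h := frobSq_add A B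
  simp only [frobSq_eq_norm_sq] at h
  have h2 := norm_add_le A B
  nlinarith [norm_nonneg (A + B), norm_nonneg A, norm_nonneg B]

theorem norm_smul_frob (r : ℝ) (hr : 0 ≤ r) (A : Matrix m m ℂ) : ‖r • A‖ = r * ‖A‖ := by
  have h : frobSq (r • A) = r ^ 2 * frobSq A := by
    rw [frobSq, frobInner_smul_right, frobInner_comm, frobInner_smul_right, frobSq]; ring
  rw [frobSq_eq_norm_sq, frobSq_eq_norm_sq, ← mul_pow] at h
  exact (pow_left_inj₀ (norm_nonneg _) (by positivity) two_ne_zero).1 h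

theorem norm_comm_le (A B : Matrix m m ℂ) : ‖A * B - B * A‖ ≤ 2 * ‖A‖ * ‖B‖ := by
  have := norm_sub_le (A * B) (B * A)
  have := norm_mul_le A B
  have := norm_mul_le B A
  linarith [mul_comm ‖A‖ ‖B‖]

theorem norm_moment_le (B : ι → Matrix m m ℂ) : ‖moment B‖ ≤ 2 * energy B := by
  rw [moment, energy, Finset.mul_sum]
  refine (norm_sum_le _ _).trans (Finset.sum_le_sum fun i _ => ?_)
  refine (norm_comm_le _ _).trans ?_
  rw [norm_conjTranspose_frob, frobSq_eq_norm_sq]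
  nlinarith

theorem isUnit_one_sub_smul_moment (B : ι → Matrix m m ℂ) {η : ℝ} (hη : 0 ≤ η)
    (hs : η * energy B ≤ 1 / 64) : IsUnit (1 - η • moment B) := by
  have hlt : ‖η • moment B‖ < 1 := by
    rw [norm_smul_frob _ hη]
    nlinarith [norm_moment_le B]
  have : CompleteSpace (Matrix m m ℂ) := FiniteDimensional.complete ℂ _
  exact isUnit_one_sub_of_norm_lt_one hlt

theorem conjTuple_sub_eq {a : Matrix m m ℂ} (ha : IsUnit (1 - a)) (B : ι → Matrix m m ℂ) (i : ι) :
    conjTuple (1 - a) B i - B i =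
      -(a * B i - B i * a) + (conjTuple (1 - a) B i - B i) * a := by
  have h : conjTuple (1 - a) B i * (1 - a) = (1 - a) * B i := by
    rw [conjTuple, mul_assoc, nonsing_inv_mul _ ((isUnit_iff_isUnit_det _).1 ha), mul_one]
  have h2 : conjTuple (1 - a) B i = (1 - a) * B i + conjTuple (1 - a) B i * a := by
    rw [← h]; noncomm_ring
  nth_rewrite 1 [h2]
  noncomm_ring

theorem conjTuple_step_norm_le (B : ι → Matrix m m ℂ) {η : ℝ} (hη : 0 ≤ η)
    (hs : η * energy B ≤ 1 / 64) (i : ι) :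
    ‖conjTuple (1 - η • moment B) B i - B i‖ ≤ 2 * η * ‖moment B * B i - B i * moment B‖ := by
  have e := conjTuple_sub_eq (isUnit_one_sub_smul_moment B hη hs) B i
  set v := conjTuple (1 - η • moment B) B i - B i
  have h1 : ‖v‖ ≤ η * ‖moment B * B i - B i * moment B‖ + ‖v‖ * (η * ‖moment B‖) := by
    calc ‖v‖ = ‖-(η • moment B * B i - B i * η • moment B) + v * η • moment B‖ :=
          congrArg _ e
      _ ≤ ‖-(η • moment B * B i - B i * η • moment B)‖ + ‖v * η • moment B‖ := norm_add_le _ _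
      _ ≤ _ := by
        rw [norm_neg, smul_mul_assoc, mul_smul_comm, ← smul_sub, norm_smul_frob _ hη]
        gcongr
        exact (norm_mul_le _ _).trans_eq (by rw [norm_smul_frob _ hη])
  have h2 : η * ‖moment B‖ ≤ 1 / 32 := by nlinarith [norm_moment_le B]
  have h3 := mul_le_mul_of_nonneg_left h2 (norm_nonneg v)
  nlinarith [norm_nonneg v]

theorem energy_step_le (B : ι → Matrix m m ℂ) {η : ℝ} (hη : 0 ≤ η)
    (hs : η * energy B ≤ 1 / 64) :
    energy (conjTuple (1 - η • moment B) B) ≤ energy B - η * frobSq (moment B) := by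
  set M := moment B with hM
  set v : ι → Matrix m m ℂ := fun i => conjTuple (1 - η • M) B i - B i with hv
  have hvn : ∀ i, ‖v i‖ ≤ 2 * η * ‖M * B i - B i * M‖ := conjTuple_step_norm_le B hη hs
  have hve : ∀ i, v i = -(η • (M * B i - B i * M)) + v i * (η • M) := fun i => by
    have := conjTuple_sub_eq (isUnit_one_sub_smul_moment B hη hs) B i
    simpa only [smul_mul_assoc, mul_smul_comm, ← smul_sub] using this
  have key : ∀ i, frobSq (conjTuple (1 - η • M) B i) ≤ frobSq (B i)
      - 2 * η * frobInner (B i) (M * B i - B i * M) + 24 * η ^ 2 * frobSq M * frobSq (B i) := by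
    intro i
    have h0 : conjTuple (1 - η • M) B i = B i + v i := by simp [hv]
    have h1 : ‖v i‖ ≤ 4 * η * ‖M‖ * ‖B i‖ := by
      have := norm_comm_le M (B i)
      nlinarith [hvn i]
    have h2 : frobInner (B i) (v i) = -(η * frobInner (B i) (M * B i - B i * M))
        + frobInner (B i) (v i * (η • M)) := by
      conv_lhs => rw [hve i]
      rw [frobInner_add_right, ← frobInner_smul_right]
      simp [frobInner]
    have h3 : frobInner (B i) (v i * (η • M)) ≤ ‖B i‖ * (‖v i‖ * (η * ‖M‖)) :=
      (frobInner_le_norm _ _).trans (by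
        gcongr
        exact (norm_mul_le _ _).trans_eq (by rw [norm_smul_frob _ hη]))
    have h4 : ‖B i‖ * (‖v i‖ * (η * ‖M‖)) ≤ ‖B i‖ * ((4 * η * ‖M‖ * ‖B i‖) * (η * ‖M‖)) := by
      gcongr
    have h5 : ‖v i‖ ^ 2 ≤ (4 * η * ‖M‖ * ‖B i‖) ^ 2 := by gcongr
    rw [h0, frobSq_add, h2, frobSq_eq_norm_sq (v i), frobSq_eq_norm_sq M, frobSq_eq_norm_sq (B i)]
    nlinarith
  have hsum := Finset.sum_le_sum fun i (_ : i ∈ Finset.univ) => key i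
  rw [Finset.sum_add_distrib, Finset.sum_sub_distrib, ← Finset.mul_sum, ← Finset.mul_sum,
    ← frobInner_moment M (moment_conjTranspose B)] at hsum
  change energy _ ≤ energy B - 2 * η * frobSq M + 24 * η ^ 2 * frobSq M * energy B at hsum
  have : 24 * η ^ 2 * frobSq M * energy B ≤ η * frobSq M := by
    have h6 : 0 ≤ η * frobSq M := mul_nonneg hη (frobSq_nonneg _)
    nlinarith
  linarith

theorem frobSq_moment_step_le (B : ι → Matrix m m ℂ) {η : ℝ} (hη : 0 ≤ η)
    (hs : η * energy B ≤ 1 / 64) :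
    frobSq (moment (conjTuple (1 - η • moment B) B)) ≤ frobSq (moment B)
      - η * ∑ i, frobSq (moment B * B i - B i * moment B) := by
  set M := moment B with hM
  set w : ι → Matrix m m ℂ := fun i => M * B i - B i * M with hw
  set S := ∑ i, frobSq (w i) with hS
  set v : ι → Matrix m m ℂ := fun i => conjTuple (1 - η • M) B i - B i with hv
  have hS0 : 0 ≤ S := Finset.sum_nonneg fun _ _ => frobSq_nonneg _
  have hvn : ∀ i, ‖v i‖ ≤ 2 * η * ‖w i‖ := conjTuple_step_norm_le B hη hs
  have hve : ∀ i, v i = -(η • w i) + v i * (η • M) := fun i => by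
    have := conjTuple_sub_eq (isUnit_one_sub_smul_moment B hη hs) B i
    simpa only [smul_mul_assoc, mul_smul_comm, ← smul_sub] using this
  have hMn : ‖M‖ ≤ 2 * energy B := norm_moment_le B
  have hηM : η * ‖M‖ ≤ 1 / 32 := by nlinarith
  have hvB : ∀ i, ‖v i‖ ≤ ‖B i‖ := fun i => by
    have := norm_comm_le M (B i)
    nlinarith [hvn i, norm_nonneg (B i), mul_le_mul_of_nonneg_right hηM (norm_nonneg (B i))]
  set D : Matrix m m ℂ :=
    ∑ i, (v i * (B i)ᴴ + B i * (v i)ᴴ - (v i)ᴴ * B i - (B i)ᴴ * v i) with hD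
  set Q : Matrix m m ℂ := ∑ i, (v i * (v i)ᴴ - (v i)ᴴ * v i) with hQ
  have hdec : moment (conjTuple (1 - η • M) B) = M + (D + Q) := by
    have hsum : ∀ C : ι → Matrix m m ℂ, (∀ i, C i = B i + v i) → moment C = moment B + (D + Q) := by
      intro C hC
      rw [moment, moment, hD, hQ, ← Finset.sum_add_distrib, ← Finset.sum_add_distrib]
      refine Finset.sum_congr rfl fun i _ => ?_
      rw [hC i, conjTranspose_add]
      noncomm_ring
    exact hsum _ fun i => by simp [hv]
  have hMD : frobInner M D ≤ -2 * η * S + 4 * η * (η * ‖M‖) * S := by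
    rw [hD, frobInner_sum_right, hS, Finset.mul_sum, Finset.mul_sum, ← Finset.sum_add_distrib]
    refine Finset.sum_le_sum fun i _ => ?_
    rw [frobInner_moment_deriv _ _ (moment_conjTranspose B)]
    change 2 * frobInner (w i) (v i) ≤ _
    have h2 : frobInner (w i) (v i) = -(η * frobSq (w i)) + frobInner (w i) (v i * (η • M)) := by
      conv_lhs => rw [hve i]
      rw [frobInner_add_right, frobSq, ← frobInner_smul_right]
      simp [frobInner]
    have h3 : frobInner (w i) (v i * (η • M)) ≤ ‖w i‖ * ((2 * η * ‖w i‖) * (η * ‖M‖)) :=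
      (frobInner_le_norm _ _).trans (by
        gcongr
        refine (norm_mul_le _ _).trans ?_
        rw [norm_smul_frob _ hη]
        gcongr
        exact hvn i)
    rw [h2, frobSq_eq_norm_sq]
    nlinarith
  have hQn : ‖Q‖ ≤ 8 * η ^ 2 * S := by
    rw [hQ, hS, Finset.mul_sum]
    refine (norm_sum_le _ _).trans (Finset.sum_le_sum fun i _ => ?_)
    refine (norm_comm_le _ _).trans ?_
    rw [norm_conjTranspose_frob, frobSq_eq_norm_sq]
    nlinarith [hvn i, norm_nonneg (v i)]
  have hMQ : frobInner M Q ≤ 16 * (η * energy B) * η * S := by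
    refine (frobInner_le_norm _ _).trans ?_
    have := energy_nonneg B
    calc ‖M‖ * ‖Q‖ ≤ (2 * energy B) * (8 * η ^ 2 * S) := by gcongr
      _ = _ := by ring
  have hDQ : ‖D + Q‖ ≤ ∑ i, ‖B i‖ * (12 * η * ‖w i‖) := by
    rw [hD, hQ, ← Finset.sum_add_distrib]
    refine (norm_sum_le _ _).trans (Finset.sum_le_sum fun i _ => ?_)
    have e : v i * (B i)ᴴ + B i * (v i)ᴴ - (v i)ᴴ * B i - (B i)ᴴ * v i +
        (v i * (v i)ᴴ - (v i)ᴴ * v i) = (v i * (B i)ᴴ - (B i)ᴴ * v i) +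
        (B i * (v i)ᴴ - (v i)ᴴ * B i) + (v i * (v i)ᴴ - (v i)ᴴ * v i) := by abel
    rw [e]
    have h1 := norm_comm_le (v i) (B i)ᴴ
    have h2 := norm_comm_le (B i) (v i)ᴴ
    have h3 := norm_comm_le (v i) (v i)ᴴ
    rw [norm_conjTranspose_frob] at h1 h2 h3
    have h4 := norm_add₃_le (a := v i * (B i)ᴴ - (B i)ᴴ * v i)
      (b := B i * (v i)ᴴ - (v i)ᴴ * B i) (c := v i * (v i)ᴴ - (v i)ᴴ * v i)
    have h5 : ‖v i‖ * ‖v i‖ ≤ ‖B i‖ * ‖v i‖ := by gcongr; exact hvB i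
    have h6 : ‖B i‖ * ‖v i‖ ≤ ‖B i‖ * (2 * η * ‖w i‖) := by gcongr; exact hvn i
    nlinarith
  have hDQ2 : ‖D + Q‖ ^ 2 ≤ 144 * (η * energy B) * η * S := by
    have hcs := Finset.sum_mul_sq_le_sq_mul_sq Finset.univ (fun i => ‖B i‖)
      (fun i => 12 * η * ‖w i‖)
    calc ‖D + Q‖ ^ 2 ≤ (∑ i, ‖B i‖ * (12 * η * ‖w i‖)) ^ 2 := by gcongr
      _ ≤ _ := hcs
      _ = _ := by
        simp only [mul_pow, ← Finset.mul_sum, ← frobSq_eq_norm_sq]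
        rw [← hS]
        change energy B * _ = _
        ring
  rw [hdec, frobSq_add, frobInner_add_right, frobSq_eq_norm_sq (D + Q)]
  have hηS : 0 ≤ η * S := mul_nonneg hη hS0
  have p1 : 4 * η * (η * ‖M‖) * S ≤ 4 * (1 / 32) * (η * S) := by nlinarith
  have p2 : 16 * (η * energy B) * η * S ≤ 16 * (1 / 64) * (η * S) := by nlinarith
  have p3 : 144 * (η * energy B) * η * S ≤ 144 * (1 / 64) * (η * S) := by nlinarith
  nlinarith

theorem sqrt_frobSq (A : Matrix m m ℂ) : Real.sqrt (frobSq A) = ‖A‖ := by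
  rw [frobSq_eq_norm_sq, Real.sqrt_sq (norm_nonneg _)]

theorem frobInner_le_sqrt (A B : Matrix m m ℂ) :
    frobInner A B ≤ Real.sqrt (frobSq A) * Real.sqrt (frobSq B) := by
  simpa only [sqrt_frobSq] using frobInner_le_norm A B

theorem sqrt_frobSq_conjTuple_step_sub_le (B : ι → Matrix m m ℂ) {η : ℝ} (hη : 0 ≤ η)
    (hs : η * energy B ≤ 1 / 64) (i : ι) :
    Real.sqrt (frobSq (conjTuple (1 - η • moment B) B i - B i)) ≤
      2 * η * Real.sqrt (∑ i, frobSq (moment B * B i - B i * moment B)) := by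
  have h := conjTuple_step_norm_le B hη hs i
  have h2 := Real.sqrt_le_sqrt (Finset.single_le_sum
    (f := fun i => frobSq (moment B * B i - B i * moment B)) (fun _ _ => frobSq_nonneg _)
    (Finset.mem_univ i))
  rw [sqrt_frobSq] at h2 ⊢
  exact h.trans (by gcongr)

end Norm

end Frobenius

section KempfNess

variable {m ι : Type*} [Fintype m] [DecidableEq m] [Fintype ι]

theorem conjTuple_mul (g h : Matrix m m ℂ) (B : ι → Matrix m m ℂ) :
    conjTuple (g * h) B = conjTuple g (conjTuple h B) := by
  funext i
  simp only [conjTuple, Matrix.mul_inv_rev, mul_assoc]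

theorem conjTuple_one (B : ι → Matrix m m ℂ) : conjTuple 1 B = B := by
  funext i
  simp [conjTuple]

theorem conjTuple_inv_conjTuple {g : Matrix m m ℂ} (hg : IsUnit g) (B : ι → Matrix m m ℂ) :
    conjTuple g⁻¹ (conjTuple g B) = B := by
  rw [← conjTuple_mul, nonsing_inv_mul _ ((isUnit_iff_isUnit_det _).1 hg), conjTuple_one]

theorem inv_eq_conjTranspose_of_unitary {U : Matrix m m ℂ} (hU : U ∈ unitaryGroup m ℂ) :
    U⁻¹ = Uᴴ :=
  inv_eq_left_inv (mem_unitaryGroup_iff'.1 hU)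

theorem conjTuple_unitary {U : Matrix m m ℂ} (hU : U ∈ unitaryGroup m ℂ)
    (B : ι → Matrix m m ℂ) (i : ι) : conjTuple U B i = U * B i * Uᴴ := by
  rw [conjTuple, inv_eq_conjTranspose_of_unitary hU]

theorem frobSq_mul_unitary {U : Matrix m m ℂ} (hU : U ∈ unitaryGroup m ℂ) (A : Matrix m m ℂ) :
    frobSq (A * U) = frobSq A := by
  have h : U * Uᴴ = 1 := mem_unitaryGroup_iff.1 hU
  rw [frobSq, frobInner, conjTranspose_mul, trace_mul_comm, mul_assoc, ← mul_assoc U, h, one_mul,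
    trace_mul_comm, frobSq, frobInner]

theorem frobSq_unitary_mul {U : Matrix m m ℂ} (hU : U ∈ unitaryGroup m ℂ) (A : Matrix m m ℂ) :
    frobSq (U * A) = frobSq A := by
  have h : Uᴴ * U = 1 := mem_unitaryGroup_iff'.1 hU
  rw [frobSq, frobInner, conjTranspose_mul, mul_assoc, ← mul_assoc Uᴴ, h, one_mul, frobSq,
    frobInner]

theorem frobSq_unitary_conj {U : Matrix m m ℂ} (hU : U ∈ unitaryGroup m ℂ) (A : Matrix m m ℂ) :
    frobSq (U * A * Uᴴ) = frobSq A := by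
  have hU' : Uᴴ ∈ unitaryGroup m ℂ := Unitary.star_mem hU
  rw [frobSq_mul_unitary hU', frobSq_unitary_mul hU]

theorem energy_conjTuple_unitary {U : Matrix m m ℂ} (hU : U ∈ unitaryGroup m ℂ)
    (B : ι → Matrix m m ℂ) : energy (conjTuple U B) = energy B := by
  simp only [energy, conjTuple_unitary hU, frobSq_unitary_conj hU]

theorem moment_conjTuple_unitary {U : Matrix m m ℂ} (hU : U ∈ unitaryGroup m ℂ)
    (B : ι → Matrix m m ℂ) : moment (conjTuple U B) = U * moment B * Uᴴ := by
  have h : Uᴴ * U = 1 := mem_unitaryGroup_iff'.1 hU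
  simp only [moment, conjTuple_unitary hU, Finset.mul_sum, Finset.sum_mul]
  refine Finset.sum_congr rfl fun i _ => ?_
  simp only [conjTranspose_mul, conjTranspose_conjTranspose, mul_sub, sub_mul]
  congr 1
  · rw [show U * B i * Uᴴ * (U * ((B i)ᴴ * Uᴴ)) = U * B i * (Uᴴ * U) * (B i)ᴴ * Uᴴ by
      simp only [mul_assoc], h]
    simp only [mul_assoc, one_mul]
  · rw [show U * ((B i)ᴴ * Uᴴ) * (U * B i * Uᴴ) = U * (B i)ᴴ * (Uᴴ * U) * B i * Uᴴ by
      simp only [mul_assoc], h]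
    simp only [mul_assoc, one_mul]

theorem frobSq_moment_conjTuple_unitary {U : Matrix m m ℂ} (hU : U ∈ unitaryGroup m ℂ)
    (B : ι → Matrix m m ℂ) : frobSq (moment (conjTuple U B)) = frobSq (moment B) := by
  rw [moment_conjTuple_unitary hU, frobSq_unitary_conj hU]

/-- The diagonal complex matrix with prescribed real entries. -/
noncomputable def realDiag (d : m → ℝ) : Matrix m m ℂ := diagonal fun k => (d k : ℂ)

open scoped ComplexOrder in
theorem posDef_eq_unitary_conj_realDiag {P : Matrix m m ℂ} (hP : P.PosDef) :
    ∃ U ∈ unitaryGroup m ℂ, ∃ d : m → ℝ, (∀ k, 0 < d k) ∧ P = U * realDiag d * Uᴴ := by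
  refine ⟨hP.1.eigenvectorUnitary, hP.1.eigenvectorUnitary.2, hP.1.eigenvalues,
    hP.eigenvalues_pos, ?_⟩
  conv_lhs => rw [hP.1.spectral_theorem]
  rfl

theorem realDiag_mul (d e : m → ℝ) : realDiag d * realDiag e = realDiag fun k => d k * e k := by
  simp [realDiag, diagonal_mul_diagonal]

theorem realDiag_conjTranspose (d : m → ℝ) : (realDiag d)ᴴ = realDiag d := by
  simp [realDiag, diagonal_conjTranspose, Pi.star_def]

theorem realDiag_one : realDiag (fun _ : m => (1 : ℝ)) = 1 := by
  simp [realDiag]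

theorem realDiag_inv {d : m → ℝ} (hd : ∀ k, 0 < d k) :
    (realDiag d)⁻¹ = realDiag fun k => (d k)⁻¹ := by
  refine inv_eq_left_inv ?_
  rw [realDiag_mul, ← realDiag_one]
  congr 1
  funext k
  exact inv_mul_cancel₀ (hd k).ne'

open scoped ComplexOrder in
theorem exists_singular_value_decomposition {g : Matrix m m ℂ} (hg : IsUnit g) :
    ∃ U ∈ unitaryGroup m ℂ, ∃ V ∈ unitaryGroup m ℂ, ∃ d : m → ℝ,
      (∀ k, 0 < d k) ∧ g = U * realDiag d * V := by
  have hP : (g * gᴴ).PosDef := by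
    have := PosDef.conjTranspose_mul_self gᴴ
      (mulVec_injective_iff_isUnit.2 ((isUnit_conjTranspose _).2 hg))
    rwa [conjTranspose_conjTranspose] at this
  obtain ⟨U, hU, e, he, hPe⟩ := posDef_eq_unitary_conj_realDiag hP
  have hU1 : Uᴴ * U = 1 := mem_unitaryGroup_iff'.1 hU
  have hU2 : U * Uᴴ = 1 := mem_unitaryGroup_iff.1 hU
  set d : m → ℝ := fun k => Real.sqrt (e k)
  have hd : ∀ k, 0 < d k := fun k => Real.sqrt_pos.2 (he k)
  have hDD : realDiag d * realDiag (fun k => (d k)⁻¹) = 1 := by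
    rw [realDiag_mul, ← realDiag_one]
    congr 1
    funext k
    exact mul_inv_cancel₀ (hd k).ne'
  refine ⟨U, hU, realDiag (fun k => (d k)⁻¹) * Uᴴ * g, ?_, d, hd, ?_⟩
  · rw [mem_unitaryGroup_iff, star_eq_conjTranspose]
    simp only [conjTranspose_mul, conjTranspose_conjTranspose, realDiag_conjTranspose]
    rw [show realDiag (fun k => (d k)⁻¹) * Uᴴ * g * (gᴴ * (U * realDiag fun k => (d k)⁻¹)) =
      realDiag (fun k => (d k)⁻¹) * Uᴴ * (g * gᴴ) * U * realDiag fun k => (d k)⁻¹ by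
        simp only [mul_assoc], hPe,
      show realDiag (fun k => (d k)⁻¹) * Uᴴ * (U * realDiag e * Uᴴ) * U *
        realDiag (fun k => (d k)⁻¹) = realDiag (fun k => (d k)⁻¹) * (Uᴴ * U) * realDiag e *
        (Uᴴ * U) * realDiag (fun k => (d k)⁻¹) by simp only [mul_assoc], hU1, mul_one, mul_one,
      realDiag_mul, realDiag_mul, ← realDiag_one]
    congr 1
    funext k
    have : e k = d k * d k := (Real.mul_self_sqrt (he k).le).symm
    rw [this]
    field_simp [(hd k).ne']
  · rw [show U * realDiag d * (realDiag (fun k => (d k)⁻¹) * Uᴴ * g) =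
      U * (realDiag d * realDiag (fun k => (d k)⁻¹)) * Uᴴ * g by simp only [mul_assoc], hDD,
      mul_one, hU2, one_mul]

theorem frobInner_realDiag_moment (W : m → ℝ) (B : ι → Matrix m m ℂ) :
    frobInner (realDiag W) (moment B) = ∑ i, ∑ k, ∑ j, (W k - W j) * ‖B i k j‖ ^ 2 := by
  rw [frobInner_moment _ (realDiag_conjTranspose W)]
  refine Finset.sum_congr rfl fun i _ => ?_
  simp only [frobInner, trace, diag_apply, mul_apply, conjTranspose_apply, Complex.re_sum]
  rw [Finset.sum_comm]
  refine Finset.sum_congr rfl fun k _ => Finset.sum_congr rfl fun j _ => ?_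
  rw [Matrix.sub_apply, realDiag, diagonal_mul, mul_diagonal, ← Complex.normSq_eq_norm_sq,
    Complex.normSq_apply]
  simp only [Complex.mul_re, Complex.star_def, Complex.conj_re, Complex.conj_im, Complex.sub_re,
    Complex.sub_im, Complex.mul_im, Complex.ofReal_re, Complex.ofReal_im]
  ring

theorem norm_sq_conjTuple_realDiag {d : m → ℝ} (hd : ∀ k, 0 < d k) (B : ι → Matrix m m ℂ)
    (i : ι) (k j : m) :
    ‖conjTuple (realDiag d) B i k j‖ ^ 2 = (d k / d j) ^ 2 * ‖B i k j‖ ^ 2 := by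
  rw [conjTuple, realDiag_inv hd, realDiag, realDiag, mul_diagonal, diagonal_mul, norm_mul,
    norm_mul, Complex.norm_real, Complex.norm_real, Real.norm_of_nonneg (hd k).le,
    Real.norm_of_nonneg (inv_pos.2 (hd j)).le]
  ring

theorem energy_eq_sum (B : ι → Matrix m m ℂ) : energy B = ∑ i, ∑ k, ∑ j, ‖B i k j‖ ^ 2 := by
  simp only [energy, frobSq_eq_sum]

theorem energy_conjTuple_realDiag_sub_le {d : m → ℝ} (hd : ∀ k, 0 < d k)
    (B : ι → Matrix m m ℂ) :
    energy (conjTuple (realDiag d) B) - energy B ≤ Real.sqrt (Fintype.card m ^ 3) *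
      (Real.sqrt (frobSq (moment (conjTuple (realDiag d) B))) +
        Real.sqrt (frobSq (moment B))) := by
  set W : m → ℝ := fun k => ((Finset.univ.filter fun j => d j < d k).card : ℝ) with hW
  have hlt : ∀ k j, d j < d k → W j + 1 ≤ W k := by
    intro k j h
    have hss : (Finset.univ.filter fun l => d l < d j) ⊂ Finset.univ.filter fun l => d l < d k := by
      refine Finset.ssubset_iff_subset_ne.2 ⟨fun l hl => ?_, fun he => ?_⟩
      · simp only [Finset.mem_filter, Finset.mem_univ, true_and] at hl ⊢
        exact hl.trans h
      · have : j ∈ Finset.univ.filter fun l => d l < d k := by simp [h]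
        rw [← he] at this
        simp at this
    have := Finset.card_lt_card hss
    simp only [hW]
    exact_mod_cast this
  have hWsq : frobSq (realDiag W) ≤ Fintype.card m ^ 3 := by
    have h1 : frobSq (realDiag W) = ∑ k, W k ^ 2 := by
      rw [frobSq, frobInner, realDiag_conjTranspose, realDiag_mul, realDiag, trace_diagonal,
        Complex.re_sum]
      simp [pow_two]
    rw [h1]
    calc ∑ k, W k ^ 2 ≤ ∑ k : m, (Fintype.card m : ℝ) ^ 2 := by
          refine Finset.sum_le_sum fun k _ => ?_
          have : W k ≤ Fintype.card m := by
            simp only [hW]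
            exact_mod_cast Finset.card_le_univ _
          have h0 : 0 ≤ W k := by positivity
          gcongr
      _ = _ := by simp; ring
  have hneg : -frobInner (realDiag W) (moment B) ≤
      Real.sqrt (frobSq (realDiag W)) * Real.sqrt (frobSq (moment B)) := by
    have h := frobInner_le_sqrt (realDiag W) (-moment B)
    simpa [frobInner, frobSq] using h
  have hpos := frobInner_le_sqrt (realDiag W) (moment (conjTuple (realDiag d) B))
  have hmain : energy (conjTuple (realDiag d) B) - energy B ≤
      frobInner (realDiag W) (moment (conjTuple (realDiag d) B)) -
        frobInner (realDiag W) (moment B) := by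
    simp only [energy_eq_sum, frobInner_realDiag_moment, ← Finset.sum_sub_distrib]
    refine Finset.sum_le_sum fun i _ => Finset.sum_le_sum fun k _ => Finset.sum_le_sum fun j _ => ?_
    rw [norm_sq_conjTuple_realDiag hd]
    have key : (d k / d j) ^ 2 - 1 ≤ (W k - W j) * ((d k / d j) ^ 2 - 1) := by
      have hr : 0 < d k / d j := div_pos (hd k) (hd j)
      rcases lt_trichotomy (d j) (d k) with h | h | h
      · have h1 : 1 < d k / d j := (one_lt_div (hd j)).2 h
        have h2 : 0 ≤ (d k / d j) ^ 2 - 1 := by nlinarith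
        nlinarith [hlt k j h]
      · simp [h, (hd k).ne']
      · have h1 : d k / d j < 1 := (div_lt_one (hd j)).2 h
        have h2 : (d k / d j) ^ 2 - 1 ≤ 0 := by nlinarith
        nlinarith [hlt j k h]
    nlinarith [mul_le_mul_of_nonneg_right key (sq_nonneg ‖B i k j‖)]
  have hs := Real.sqrt_le_sqrt hWsq
  have e1 := mul_le_mul_of_nonneg_right hs (Real.sqrt_nonneg (frobSq (moment B)))
  have e2 := mul_le_mul_of_nonneg_right hs
    (Real.sqrt_nonneg (frobSq (moment (conjTuple (realDiag d) B))))
  linarith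

theorem energy_conjTuple_sub_le {g : Matrix m m ℂ} (hg : IsUnit g) (B : ι → Matrix m m ℂ) :
    energy (conjTuple g B) - energy B ≤ Real.sqrt (Fintype.card m ^ 3) *
      (Real.sqrt (frobSq (moment (conjTuple g B))) + Real.sqrt (frobSq (moment B))) := by
  obtain ⟨U, hU, V, hV, d, hd, rfl⟩ := exists_singular_value_decomposition hg
  rw [conjTuple_mul, conjTuple_mul, energy_conjTuple_unitary hU,
    frobSq_moment_conjTuple_unitary hU]
  have := energy_conjTuple_realDiag_sub_le hd (conjTuple V B)
  rwa [energy_conjTuple_unitary hV, frobSq_moment_conjTuple_unitary hV] at this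

/-- The infimum of the energy on the conjugation orbit of a tuple of matrices. -/
noncomputable def infEnergy (B : ι → Matrix m m ℂ) : ℝ :=
  ⨅ g : (Matrix m m ℂ)ˣ, energy (conjTuple (g : Matrix m m ℂ) B)

theorem infEnergy_le (B : ι → Matrix m m ℂ) {g : Matrix m m ℂ} (hg : IsUnit g) :
    infEnergy B ≤ energy (conjTuple g B) :=
  ciInf_le ⟨0, by rintro _ ⟨h, rfl⟩; exact energy_nonneg _⟩ hg.unit

theorem infEnergy_le_energy (B : ι → Matrix m m ℂ) : infEnergy B ≤ energy B := by
  simpa [conjTuple_one] using infEnergy_le B isUnit_one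

theorem infEnergy_conjTuple {g : Matrix m m ℂ} (hg : IsUnit g) (B : ι → Matrix m m ℂ) :
    infEnergy (conjTuple g B) = infEnergy B := by
  refine le_antisymm (le_ciInf fun h => ?_) (le_ciInf fun h => ?_)
  · have := infEnergy_le (conjTuple g B) (h.isUnit.mul ((isUnit_nonsing_inv_iff).2 hg))
    rwa [conjTuple_mul, conjTuple_inv_conjTuple hg] at this
  · rw [← conjTuple_mul]
    exact infEnergy_le B (h.isUnit.mul hg)

theorem frobSq_moment_le_of_energy_le {B : ι → Matrix m m ℂ} {ε : ℝ}
    (h : energy B ≤ infEnergy B + ε) :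
    frobSq (moment B) ≤ 64 * (1 + infEnergy B + ε) * ε := by
  have h0 := energy_nonneg B
  set η : ℝ := 1 / (64 * (1 + energy B)) with hη
  have hη0 : 0 ≤ η := by positivity
  have hs : η * energy B ≤ 1 / 64 := by
    rw [hη, div_mul_eq_mul_div, div_le_div_iff₀ (by positivity) (by norm_num)]
    nlinarith
  have h1 := energy_step_le B hη0 hs
  have h2 := infEnergy_le B (isUnit_one_sub_smul_moment B hη0 hs)
  have h3 : η * frobSq (moment B) ≤ ε := by linarith
  have h4 : frobSq (moment B) = 64 * (1 + energy B) * (η * frobSq (moment B)) := by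
    rw [hη]; field_simp
  have h5 : 0 ≤ ε := (mul_nonneg hη0 (frobSq_nonneg _)).trans h3
  rw [h4]
  calc 64 * (1 + energy B) * (η * frobSq (moment B)) ≤ 64 * (1 + energy B) * ε := by gcongr
    _ ≤ _ := by
      refine mul_le_mul_of_nonneg_right ?_ h5
      linarith

/-- A Łojasiewicz-type inequality for the energy on a conjugation orbit. -/
theorem energy_sub_infEnergy_le (B : ι → Matrix m m ℂ) :
    energy B - infEnergy B ≤
      Real.sqrt (Fintype.card m ^ 3) * Real.sqrt (frobSq (moment B)) := by
  set C := Real.sqrt (Fintype.card m ^ 3) with hC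
  have key : ∀ ε : ℝ, 0 < ε → energy B - infEnergy B ≤
      ε + C * (Real.sqrt (frobSq (moment B)) +
        Real.sqrt (64 * (1 + infEnergy B + ε) * ε)) := by
    intro ε hε
    obtain ⟨g, hg⟩ := exists_lt_of_ciInf_lt (show infEnergy B < infEnergy B + ε by linarith)
    have h1 := energy_conjTuple_sub_le ((isUnit_nonsing_inv_iff).2 g.isUnit)
      (conjTuple (g : Matrix m m ℂ) B)
    rw [conjTuple_inv_conjTuple g.isUnit] at h1
    have h2 := frobSq_moment_le_of_energy_le (B := conjTuple (g : Matrix m m ℂ) B) (ε := ε)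
      (by rw [infEnergy_conjTuple g.isUnit]; exact hg.le)
    rw [infEnergy_conjTuple g.isUnit] at h2
    have h3 := mul_le_mul_of_nonneg_left (Real.sqrt_le_sqrt h2) (Real.sqrt_nonneg
      (Fintype.card m ^ 3 : ℝ))
    rw [← hC] at h1 h3
    linarith
  have hlim : Filter.Tendsto (fun ε : ℝ => ε + C * (Real.sqrt (frobSq (moment B)) +
        Real.sqrt (64 * (1 + infEnergy B + ε) * ε))) (nhdsWithin 0 (Set.Ioi 0))
        (nhds (C * Real.sqrt (frobSq (moment B)))) := by
    refine Filter.Tendsto.mono_left ?_ nhdsWithin_le_nhds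
    have hc : Continuous fun ε : ℝ => ε + C * (Real.sqrt (frobSq (moment B)) +
        Real.sqrt (64 * (1 + infEnergy B + ε) * ε)) := by fun_prop
    simpa using hc.tendsto 0
  exact ge_of_tendsto hlim (by filter_upwards [self_mem_nhdsWithin] with ε hε using key ε hε)

/-- Two points of an orbit with the same energy, one of which is critical, differ by
a matrix whose polar part commutes with the tuple. -/
theorem commute_conjTranspose_mul_self_of_energy_eq {B : ι → Matrix m m ℂ} (hB : moment B = 0)
    {g : Matrix m m ℂ} (hg : IsUnit g) (h : energy (conjTuple g B) = energy B) (i : ι) :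
    Commute (gᴴ * g) (B i) := by
  obtain ⟨U, hU, V, hV, d, hd, rfl⟩ := exists_singular_value_decomposition hg
  have hU1 : Uᴴ * U = 1 := mem_unitaryGroup_iff'.1 hU
  have hV1 : Vᴴ * V = 1 := mem_unitaryGroup_iff'.1 hV
  set τ := conjTuple V B with hτ
  have hτ0 : moment τ = 0 := by rw [hτ, moment_conjTuple_unitary hV, hB]; simp
  rw [conjTuple_mul, conjTuple_mul, energy_conjTuple_unitary hU,
    ← energy_conjTuple_unitary hV B, ← hτ] at h
  have hw := frobInner_realDiag_moment (fun k => Real.log (d k)) τ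
  rw [hτ0] at hw
  have hnn : ∀ k j, 0 ≤ (d k / d j) ^ 2 - 1 - 2 * (Real.log (d k) - Real.log (d j)) := by
    intro k j
    have hr : 0 < d k / d j := div_pos (hd k) (hd j)
    have := Real.log_le_sub_one_of_pos (pow_pos hr 2)
    rw [Real.log_pow, Real.log_div (hd k).ne' (hd j).ne'] at this
    push_cast at this
    linarith
  have hsum : ∑ i, ∑ k, ∑ j, ((d k / d j) ^ 2 - 1 - 2 * (Real.log (d k) - Real.log (d j))) *
      ‖τ i k j‖ ^ 2 = 0 := by
    have h1 : ∑ i, ∑ k, ∑ j, (d k / d j) ^ 2 * ‖τ i k j‖ ^ 2 - ∑ i, ∑ k, ∑ j, ‖τ i k j‖ ^ 2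
        - 2 * ∑ i, ∑ k, ∑ j, (Real.log (d k) - Real.log (d j)) * ‖τ i k j‖ ^ 2 = 0 := by
      rw [← hw, ← energy_eq_sum]
      simp only [← norm_sq_conjTuple_realDiag hd, ← energy_eq_sum]
      rw [h]
      simp [frobInner]
    rw [← h1]
    simp only [Finset.mul_sum, ← Finset.sum_sub_distrib]
    refine Finset.sum_congr rfl fun i _ => Finset.sum_congr rfl fun k _ =>
      Finset.sum_congr rfl fun j _ => ?_
    ring
  have hzero : ∀ k j, ((d k / d j) ^ 2 - 1 - 2 * (Real.log (d k) - Real.log (d j))) *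
      ‖τ i k j‖ ^ 2 = 0 := by
    have hterm : ∀ i k j, 0 ≤ ((d k / d j) ^ 2 - 1 - 2 * (Real.log (d k) - Real.log (d j))) *
      ‖τ i k j‖ ^ 2 := fun i k j => mul_nonneg (hnn k j) (sq_nonneg _)
    intro k j
    have a1 := (Finset.sum_eq_zero_iff_of_nonneg fun i _ => Finset.sum_nonneg fun k _ =>
      Finset.sum_nonneg fun j _ => hterm i k j).1 hsum i (Finset.mem_univ _)
    have a2 := (Finset.sum_eq_zero_iff_of_nonneg fun k _ =>
      Finset.sum_nonneg fun j _ => hterm i k j).1 a1 k (Finset.mem_univ _)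
    exact (Finset.sum_eq_zero_iff_of_nonneg fun j _ => hterm i k j).1 a2 j (Finset.mem_univ _)
  have hτij : ∀ k j, d k ≠ d j → τ i k j = 0 := by
    intro k j hkj
    have hr : 0 < d k / d j := div_pos (hd k) (hd j)
    have hne : (d k / d j) ^ 2 ≠ 1 := by
      intro he
      have : d k / d j = 1 := by nlinarith
      exact hkj ((div_eq_one_iff_eq (hd j).ne').1 this)
    have := Real.log_lt_sub_one_of_pos (pow_pos hr 2) hne
    rw [Real.log_pow, Real.log_div (hd k).ne' (hd j).ne'] at this
    push_cast at this
    rcases mul_eq_zero.1 (hzero k j) with h0 | h0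
    · linarith
    · simpa using h0
  have hcomm : realDiag (fun k => d k * d k) * τ i = τ i * realDiag (fun k => d k * d k) := by
    ext k j
    rw [realDiag, diagonal_mul, mul_diagonal]
    by_cases hkj : d k = d j
    · rw [hkj, mul_comm]
    · simp [hτij k j hkj]
  have hgg : (U * realDiag d * V)ᴴ * (U * realDiag d * V) =
      Vᴴ * realDiag (fun k => d k * d k) * V := by
    simp only [conjTranspose_mul, realDiag_conjTranspose]
    rw [show Vᴴ * (realDiag d * Uᴴ) * (U * realDiag d * V) =
      Vᴴ * (realDiag d * (Uᴴ * U) * realDiag d) * V by simp only [mul_assoc], hU1, mul_one,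
      realDiag_mul]
  have hBi : B i = Vᴴ * τ i * V := by
    rw [hτ, conjTuple_unitary hV, show Vᴴ * (V * B i * Vᴴ) * V = (Vᴴ * V) * B i * (Vᴴ * V) by
      simp only [mul_assoc], hV1, one_mul, mul_one]
  have hV2 : V * Vᴴ = 1 := mem_unitaryGroup_iff.1 hV
  have cong : ∀ X Y : Matrix m m ℂ, (Vᴴ * X * V) * (Vᴴ * Y * V) = Vᴴ * (X * Y) * V := by
    intro X Y
    rw [show (Vᴴ * X * V) * (Vᴴ * Y * V) = Vᴴ * X * (V * Vᴴ) * Y * V by simp only [mul_assoc],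
      hV2, mul_one]
    simp only [mul_assoc]
  rw [hgg, hBi, Commute, SemiconjBy, cong, cong, hcomm]

end KempfNess

section Lyapunov

variable {m ι : Type*} [Fintype m] [DecidableEq m] [Fintype ι]

theorem two_mul_le_of_quartic_descent {p p₁ q q₁ T η D : ℝ} (hq0 : 0 < q)
    (hq₁0 : 0 ≤ q₁) (hp : p₁ ≤ p) (hq : q₁ ≤ q) (hη : 0 ≤ η) (hD : 1 ≤ D)
    (hpq : p ≤ D * q) (hf : p₁ ^ 2 ≤ p ^ 2 - η * q ^ 4) (hg : q₁ ^ 4 ≤ q ^ 4 - η * T ^ 2) :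
    2 * η * T ≤ 4 * D * ((p - p₁) + (q - q₁)) := by
  have a1 : η * q ^ 3 ≤ 2 * D * (p - p₁) := by
    have h1 : η * q ^ 4 ≤ (p - p₁) * (2 * p) := by nlinarith
    have h2 : (p - p₁) * (2 * p) ≤ (p - p₁) * (2 * (D * q)) :=
      mul_le_mul_of_nonneg_left (by linarith) (sub_nonneg.2 hp)
    have h3 : η * q ^ 3 * q ≤ 2 * D * (p - p₁) * q := by linarith
    exact le_of_mul_le_mul_right h3 hq0
  have a2 : η * T ^ 2 ≤ 4 * q ^ 3 * (q - q₁) := by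
    have h1 : η * T ^ 2 ≤ (q - q₁) * ((q + q₁) * (q ^ 2 + q₁ ^ 2)) := by linarith
    have h2 : (q + q₁) * (q ^ 2 + q₁ ^ 2) ≤ (q + q) * (q ^ 2 + q ^ 2) := by gcongr
    linarith [mul_le_mul_of_nonneg_left h2 (sub_nonneg.2 hq)]
  have hy : 0 < q ^ 3 := pow_pos hq0 3
  generalize q ^ 3 = y at a1 a2 hy
  have a3 : 2 * η * T * y ≤ 4 * D * ((p - p₁) + (q - q₁)) * y := by
    have b1 : η * y * y ≤ 2 * D * (p - p₁) * y := mul_le_mul_of_nonneg_right a1 hy.le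
    have b2 : 0 ≤ (D - 1) * (y * (q - q₁)) :=
      mul_nonneg (sub_nonneg.2 hD) (mul_nonneg hy.le (sub_nonneg.2 hq))
    have b3 : 0 ≤ D * (p - p₁) * y :=
      mul_nonneg (mul_nonneg (by linarith) (sub_nonneg.2 hp)) hy.le
    have b4 := mul_nonneg hη (sq_nonneg (T - y))
    linarith
  exact le_of_mul_le_mul_right a3 hy

theorem two_mul_sqrt_le_of_descent {f₀ f₁ g₀ g₁ S η C : ℝ} (hf₁ : 0 ≤ f₁)
    (hg₁ : 0 ≤ g₁) (hS : 0 ≤ S) (hη : 0 ≤ η) (hf : f₁ ≤ f₀ - η * g₀)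
    (hg : g₁ ≤ g₀ - η * S) (hfg : f₀ ≤ C * √g₀) (hC : 0 ≤ C) :
    2 * η * √S ≤ 4 * (√C + 1) * ((√f₀ + √√g₀) - (√f₁ + √√g₁)) := by
  have hηS : 0 ≤ η * S := mul_nonneg hη hS
  have hg₀ : 0 ≤ g₀ := by linarith
  have hηg : 0 ≤ η * g₀ := mul_nonneg hη hg₀
  have hf₀ : 0 ≤ f₀ := by linarith
  have hD : 1 ≤ √C + 1 := by linarith [Real.sqrt_nonneg C]
  have hp : √f₁ ≤ √f₀ := Real.sqrt_le_sqrt (by linarith)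
  have hq : √√g₁ ≤ √√g₀ := Real.sqrt_le_sqrt (Real.sqrt_le_sqrt (by linarith))
  have hrhs : 0 ≤ 4 * (√C + 1) * ((√f₀ + √√g₀) - (√f₁ + √√g₁)) :=
    mul_nonneg (by linarith) (by linarith)
  rcases hη.eq_or_lt with rfl | hη'
  · simpa using hrhs
  rcases hS.eq_or_lt with rfl | hS'
  · simpa using hrhs
  have hg₀' : 0 < g₀ := by nlinarith [mul_pos hη' hS']
  have hf₀' : 0 < f₀ := by nlinarith [mul_pos hη' hg₀']
  have hpq : √f₀ ≤ (√C + 1) * √√g₀ := by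
    have h1 : √f₀ ≤ √(C * √g₀) := Real.sqrt_le_sqrt hfg
    rw [Real.sqrt_mul hC] at h1
    linarith [Real.sqrt_nonneg √g₀]
  have quartic : ∀ {x : ℝ}, 0 ≤ x → √√x ^ 4 = x := fun {x} hx => by
    rw [show √√x ^ 4 = (√√x ^ 2) ^ 2 by ring, Real.sq_sqrt (Real.sqrt_nonneg _), Real.sq_sqrt hx]
  refine (two_mul_le_of_quartic_descent
    (Real.sqrt_pos.2 (Real.sqrt_pos.2 hg₀')) (Real.sqrt_nonneg √g₁)
    hp hq hη hD hpq ?_ ?_).trans_eq ?_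
  · rwa [Real.sq_sqrt hf₀, Real.sq_sqrt hf₁, quartic hg₀]
  · rwa [quartic hg₀, quartic hg₁, Real.sq_sqrt hS]
  · ring

/-- The excess of the energy over its infimum on the conjugation orbit. -/
noncomputable def excess (B : ι → Matrix m m ℂ) : ℝ := energy B - infEnergy B

/-- A function bounding the length of the trajectories of the discrete moment map flow. -/
noncomputable def lyapunov (B : ι → Matrix m m ℂ) : ℝ :=
  √(excess B) + √√(frobSq (moment B))

/-- The constant in the Łojasiewicz-type inequality. -/
noncomputable def orbitConst (m : Type*) [Fintype m] : ℝ := √(Fintype.card m ^ 3)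

theorem excess_nonneg (B : ι → Matrix m m ℂ) : 0 ≤ excess B :=
  sub_nonneg.2 (infEnergy_le_energy B)

theorem lyapunov_nonneg (B : ι → Matrix m m ℂ) : 0 ≤ lyapunov B :=
  add_nonneg (Real.sqrt_nonneg _) (Real.sqrt_nonneg _)

theorem lyapunov_le (B : ι → Matrix m m ℂ) :
    lyapunov B ≤ (√(orbitConst m) + 1) * √√(frobSq (moment B)) := by
  have h := Real.sqrt_le_sqrt (energy_sub_infEnergy_le B)
  rw [Real.sqrt_mul (Real.sqrt_nonneg _)] at h
  change √(excess B) ≤ √(orbitConst m) * _ at h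
  rw [lyapunov]
  linarith

theorem sqrt_frobSq_step_le_lyapunov_sub (B : ι → Matrix m m ℂ) {η : ℝ} (hη : 0 ≤ η)
    (hs : η * energy B ≤ 1 / 64) (i : ι) :
    √(frobSq (conjTuple (1 - η • moment B) B i - B i)) ≤ 4 * (√(orbitConst m) + 1) *
      (lyapunov B - lyapunov (conjTuple (1 - η • moment B) B)) := by
  refine (sqrt_frobSq_conjTuple_step_sub_le B hη hs i).trans ?_
  refine two_mul_sqrt_le_of_descent (excess_nonneg _) (frobSq_nonneg _)
    (Finset.sum_nonneg fun _ _ => frobSq_nonneg _) hη ?_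
    (frobSq_moment_step_le B hη hs) (energy_sub_infEnergy_le B) (Real.sqrt_nonneg _)
  rw [excess, excess, infEnergy_conjTuple (isUnit_one_sub_smul_moment B hη hs)]
  linarith [energy_step_le B hη hs]

theorem sqrt_frobSq_sub_le (A B C : Matrix m m ℂ) :
    √(frobSq (A - C)) ≤ √(frobSq (A - B)) + √(frobSq (B - C)) := by
  have h0 := frobInner_le_sqrt (A - B) (B - C)
  have h1 := frobSq_add (A - B) (B - C)
  rw [sub_add_sub_cancel] at h1
  rw [Real.sqrt_le_left (by positivity), h1]
  nlinarith [Real.sq_sqrt (frobSq_nonneg (A - B)), Real.sq_sqrt (frobSq_nonneg (B - C))]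

end Lyapunov

section Flow

variable {Γ : Type} [Group Γ] {n : ℕ} (S : Finset Γ)

/-- Conjugation of a representation by an invertible matrix. -/
noncomputable def repConj (g : Matrix (Fin n) (Fin n) ℂ) (hg : IsUnit g) (ρ : RepGL Γ n) :
    RepGL Γ n :=
  ⟨fun γ => g * ρ.1 γ * g⁻¹, by
    have hdet := (isUnit_iff_isUnit_det _).1 hg
    refine ⟨?_, fun a b => ?_, fun γ => ?_⟩
    · beta_reduce
      rw [ρ.2.1, mul_one, mul_nonsing_inv _ hdet]
    · beta_reduce
      rw [ρ.2.2.1, show g * ρ.1 a * g⁻¹ * (g * ρ.1 b * g⁻¹) =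
        g * ρ.1 a * (g⁻¹ * g) * ρ.1 b * g⁻¹ by simp only [mul_assoc], nonsing_inv_mul _ hdet,
        mul_one]
      simp only [mul_assoc]
    · exact (hg.mul (ρ.2.2.2 γ)).mul (isUnit_nonsing_inv_iff.2 hg)⟩

/-- The restriction of a representation to a finite set of group elements. -/
def repTuple (ρ : RepGL Γ n) : S → Matrix (Fin n) (Fin n) ℂ := fun i => ρ.1 i

/-- The step size of the discrete moment map flow. -/
noncomputable def stepSize {ι : Type*} [Fintype ι] (u : ℝ)
    (B : ι → Matrix (Fin n) (Fin n) ℂ) : ℝ := u / (64 * (1 + energy B))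

theorem stepSize_nonneg {ι : Type*} [Fintype ι] (u : unitInterval)
    (B : ι → Matrix (Fin n) (Fin n) ℂ) : 0 ≤ stepSize u B :=
  div_nonneg u.2.1 (by linarith [energy_nonneg B])

theorem stepSize_mul_energy_le {ι : Type*} [Fintype ι] (u : unitInterval)
    (B : ι → Matrix (Fin n) (Fin n) ℂ) : stepSize u B * energy B ≤ 1 / 64 := by
  have h := energy_nonneg B
  rw [stepSize, div_mul_eq_mul_div, div_le_div_iff₀ (by positivity) (by norm_num)]
  nlinarith [u.2.1, u.2.2, mul_le_mul_of_nonneg_right u.2.2 h]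

/-- A partial step of the discrete moment map flow on representations. -/
noncomputable def flowStep (u : unitInterval) (ρ : RepGL Γ n) : RepGL Γ n :=
  repConj (1 - stepSize u (repTuple S ρ) • moment (repTuple S ρ))
    (isUnit_one_sub_smul_moment _ (stepSize_nonneg _ _) (stepSize_mul_energy_le _ _)) ρ

theorem flowStep_of_smul_eq_zero {u : unitInterval} {ρ : RepGL Γ n}
    (h : stepSize u (repTuple S ρ) • moment (repTuple S ρ) = 0) : flowStep S u ρ = ρ := by
  refine Subtype.ext (funext fun γ => ?_)
  simp [flowStep, repConj, h]

theorem flowStep_zero (ρ : RepGL Γ n) : flowStep S 0 ρ = ρ :=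
  flowStep_of_smul_eq_zero S (by simp [stepSize])

theorem flowStep_of_moment_eq_zero (u : unitInterval) {ρ : RepGL Γ n}
    (h : moment (repTuple S ρ) = 0) : flowStep S u ρ = ρ :=
  flowStep_of_smul_eq_zero S (by rw [h, smul_zero])

theorem continuous_repTuple_apply (γ : Γ) : Continuous fun ρ : RepGL Γ n => ρ.1 γ :=
  (continuous_apply γ).comp continuous_subtype_val

theorem continuous_energy {ι : Type*} [Fintype ι] :
    Continuous (energy : (ι → Matrix (Fin n) (Fin n) ℂ) → ℝ) := by
  unfold energy frobSq frobInner
  fun_prop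

theorem continuous_moment {ι : Type*} [Fintype ι] :
    Continuous (moment : (ι → Matrix (Fin n) (Fin n) ℂ) → Matrix (Fin n) (Fin n) ℂ) := by
  unfold moment
  fun_prop

theorem continuous_frobSq : Continuous (frobSq : Matrix (Fin n) (Fin n) ℂ → ℝ) := by
  unfold frobSq frobInner
  fun_prop

theorem continuous_repTuple : Continuous (repTuple S : RepGL Γ n → _) :=
  continuous_pi fun i => continuous_repTuple_apply i.1

theorem continuousAt_inv_matrix {A : Matrix (Fin n) (Fin n) ℂ} (hA : IsUnit A) :
    ContinuousAt (fun X : Matrix (Fin n) (Fin n) ℂ => X⁻¹) A := by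
  have hd : A.det ≠ 0 := ((isUnit_iff_isUnit_det _).1 hA).ne_zero
  simp only [inv_def, Ring.inverse_eq_inv']
  refine ContinuousAt.smul (ContinuousAt.inv₀ ?_ hd) ?_
  · exact (continuous_id.matrix_det).continuousAt
  · exact (continuous_id.matrix_adjugate).continuousAt

theorem continuous_flowStep :
    Continuous fun x : unitInterval × RepGL Γ n => flowStep S x.1 x.2 := by
  refine Continuous.subtype_mk (continuous_pi fun γ => ?_) _
  have hg : Continuous fun x : unitInterval × RepGL Γ n =>
      1 - stepSize x.1 (repTuple S x.2) • moment (repTuple S x.2) := by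
    have h1 : Continuous fun x : unitInterval × RepGL Γ n => repTuple S x.2 :=
      (continuous_repTuple S).comp continuous_snd
    have h2 : Continuous fun x : unitInterval × RepGL Γ n => energy (repTuple S x.2) :=
      continuous_energy.comp h1
    have h3 : Continuous fun x : unitInterval × RepGL Γ n => moment (repTuple S x.2) :=
      continuous_moment.comp h1
    suffices h4 : Continuous fun x : unitInterval × RepGL Γ n =>
        stepSize (x.1 : ℝ) (repTuple S x.2) from continuous_const.sub (h4.smul h3)
    refine (continuous_subtype_val.comp continuous_fst).div
      (continuous_const.mul (continuous_const.add h2)) fun x => ?_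
    have := energy_nonneg (repTuple S x.2)
    positivity
  refine (hg.mul ((continuous_repTuple_apply γ).comp continuous_snd)).mul ?_
  refine continuous_iff_continuousAt.2 fun x => ?_
  exact (continuousAt_inv_matrix (isUnit_one_sub_smul_moment _ (stepSize_nonneg x.1 _)
    (stepSize_mul_energy_le _ _))).comp (f := fun x : unitInterval × RepGL Γ n =>
      1 - stepSize x.1 (repTuple S x.2) • moment (repTuple S x.2)) hg.continuousAt

/-- Two representations are related by conjugation with the unitary matrix `U`. -/
def UnitaryConj (U : Matrix (Fin n) (Fin n) ℂ) (ρ σ : RepGL Γ n) : Prop :=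
  ∀ γ, σ.1 γ = U * ρ.1 γ * star U

theorem UnitaryConj.flowStep {U : Matrix (Fin n) (Fin n) ℂ} (hU : U ∈ unitaryGroup (Fin n) ℂ)
    {ρ σ : RepGL Γ n} (h : UnitaryConj U ρ σ) (u : unitInterval) :
    UnitaryConj U (flowStep S u ρ) (flowStep S u σ) := by
  have ht : repTuple S σ = conjTuple U (repTuple S ρ) := by
    funext i
    rw [conjTuple_unitary hU]
    exact h i
  have hU1 : U * Uᴴ = 1 := mem_unitaryGroup_iff.1 hU
  have hU2 : Uᴴ * U = 1 := mem_unitaryGroup_iff'.1 hU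
  intro γ
  set g := 1 - stepSize u (repTuple S ρ) • moment (repTuple S ρ) with hg
  have hgσ : 1 - stepSize u (repTuple S σ) • moment (repTuple S σ) = U * g * Uᴴ := by
    rw [ht, stepSize, energy_conjTuple_unitary hU, moment_conjTuple_unitary hU, hg, mul_sub,
      sub_mul, mul_one, hU1, mul_smul_comm, smul_mul_assoc, stepSize]
  change (1 - stepSize u (repTuple S σ) • moment (repTuple S σ)) * σ.1 γ *
    (1 - stepSize u (repTuple S σ) • moment (repTuple S σ))⁻¹ = U * (g * ρ.1 γ * g⁻¹) * Uᴴ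
  rw [hgσ, h γ, Matrix.mul_inv_rev, Matrix.mul_inv_rev, inv_eq_conjTranspose_of_unitary hU,
    inv_eq_left_inv hU1, star_eq_conjTranspose]
  rw [show U * g * Uᴴ * (U * ρ.1 γ * Uᴴ) * (U * (g⁻¹ * Uᴴ)) =
    U * g * (Uᴴ * U) * ρ.1 γ * (Uᴴ * U) * g⁻¹ * Uᴴ by simp only [mul_assoc], hU2]
  simp only [mul_assoc, one_mul]

/-- The time, clipped to the unit interval, that the flow spends in its `N`-th step. -/
noncomputable def stepTime (N : ℕ) (t : unitInterval) : unitInterval :=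
  Set.projIcc (0 : ℝ) 1 zero_le_one ((((N : ℝ) + 1) * t - N) * (N + 2))

theorem continuous_stepTime (N : ℕ) : Continuous (stepTime N) := by
  unfold stepTime
  exact continuous_projIcc.comp (by fun_prop)

theorem stepTime_zero (N : ℕ) : stepTime N 0 = 0 :=
  Set.projIcc_of_le_left _ (by simp; positivity)

theorem stepTime_one (N : ℕ) : stepTime N 1 = 1 :=
  Set.projIcc_of_right_le _ (by
    have : (0 : ℝ) ≤ N := Nat.cast_nonneg N
    simp only [unitInterval, Set.Icc.coe_one]
    nlinarith)

theorem stepTime_eq_zero_or (N : ℕ) (t : unitInterval) :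
    (∀ j, N ≤ j → stepTime j t = 0) ∨ ∀ j, j < N → stepTime j t = 1 := by
  have h1 : (t : ℝ) ≤ 1 := t.2.2
  have h0 : (0 : ℝ) ≤ t := t.2.1
  rcases le_or_gt (((N : ℝ) + 1) * t) N with h | h
  · refine Or.inl fun j hj => Set.projIcc_of_le_left _ ?_
    have hj' : (N : ℝ) ≤ j := by exact_mod_cast hj
    have : ((j : ℝ) + 1) * t - j ≤ 0 := by nlinarith
    exact mul_nonpos_of_nonpos_of_nonneg this (by positivity)
  · refine Or.inr fun j hj => Set.projIcc_of_right_le _ ?_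
    have hj' : (j : ℝ) + 1 ≤ N := by exact_mod_cast hj
    have hj0 : (0 : ℝ) ≤ j := Nat.cast_nonneg j
    have h2 : ((j : ℝ) + 2) * (1 - t) ≤ 1 := by nlinarith
    nlinarith

/-- The discrete moment map flow, after `N` steps. -/
noncomputable def flow : ℕ → RepGL Γ n × unitInterval → RepGL Γ n
  | 0, x => x.1
  | N + 1, x => flowStep S (stepTime N x.2) (flow N x)

theorem continuous_flow (N : ℕ) : Continuous (flow S N : RepGL Γ n × unitInterval → _) := by
  induction N with
  | zero => exact continuous_fst
  | succ N ih =>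
    have h : Continuous fun x : RepGL Γ n × unitInterval => (stepTime N x.2, flow S N x) :=
      ((continuous_stepTime N).comp continuous_snd).prodMk ih
    have h' := (continuous_flowStep S).comp h
    exact h'

theorem flow_time_zero (N : ℕ) (ρ : RepGL Γ n) : flow S N (ρ, 0) = ρ := by
  induction N with
  | zero => rfl
  | succ N ih => rw [flow, ih, stepTime_zero, flowStep_zero]

theorem flow_of_moment_eq_zero (N : ℕ) {ρ : RepGL Γ n} (h : moment (repTuple S ρ) = 0)
    (t : unitInterval) : flow S N (ρ, t) = ρ := by
  induction N with
  | zero => rfl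
  | succ N ih => rw [flow, ih, flowStep_of_moment_eq_zero S _ h]

theorem UnitaryConj.flow {U : Matrix (Fin n) (Fin n) ℂ} (hU : U ∈ unitaryGroup (Fin n) ℂ)
    {ρ σ : RepGL Γ n} (h : UnitaryConj U ρ σ) (t : unitInterval) (N : ℕ) :
    UnitaryConj U (flow S N (ρ, t)) (flow S N (σ, t)) := by
  induction N with
  | zero => exact h
  | succ N ih => exact UnitaryConj.flowStep S hU ih _

theorem det_flow (N : ℕ) (x : RepGL Γ n × unitInterval) (γ : Γ) :
    ((flow S N x).1 γ).det = (x.1.1 γ).det := by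
  induction N with
  | zero => rfl
  | succ N ih =>
    rw [← ih]
    exact det_conj (isUnit_one_sub_smul_moment _ (stepSize_nonneg _ _)
      (stepSize_mul_energy_le _ _)) _

theorem energy_flow_succ_le (N : ℕ) (x : RepGL Γ n × unitInterval) :
    energy (repTuple S (flow S (N + 1) x)) ≤ energy (repTuple S (flow S N x)) -
      stepSize (stepTime N x.2) (repTuple S (flow S N x)) *
        frobSq (moment (repTuple S (flow S N x))) :=
  energy_step_le _ (stepSize_nonneg _ _) (stepSize_mul_energy_le _ _)

theorem frobSq_moment_flow_succ_le (N : ℕ) (x : RepGL Γ n × unitInterval) :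
    frobSq (moment (repTuple S (flow S (N + 1) x))) ≤
      frobSq (moment (repTuple S (flow S N x))) :=
  (frobSq_moment_step_le _ (stepSize_nonneg _ _) (stepSize_mul_energy_le _ _)).trans
    (sub_le_self _ (mul_nonneg (stepSize_nonneg _ _)
      (Finset.sum_nonneg fun _ _ => frobSq_nonneg _)))

theorem energy_flow_le (N : ℕ) (x : RepGL Γ n × unitInterval) :
    energy (repTuple S (flow S N x)) ≤ energy (repTuple S x.1) := by
  induction N with
  | zero => rfl
  | succ N ih =>
    have := energy_flow_succ_le S N x
    have := mul_nonneg (stepSize_nonneg (stepTime N x.2) (repTuple S (flow S N x)))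
      (frobSq_nonneg (moment (repTuple S (flow S N x))))
    linarith

theorem energy_flow_add_le {N : ℕ} {x : RepGL Γ n × unitInterval}
    (h : ∀ j, j < N → stepTime j x.2 = 1) :
    energy (repTuple S (flow S N x)) + N * stepSize 1 (repTuple S x.1) *
      frobSq (moment (repTuple S (flow S N x))) ≤ energy (repTuple S x.1) := by
  induction N with
  | zero => simp [flow]
  | succ N ih =>
    have h1 := ih fun j hj => h j (hj.trans N.lt_succ_self)
    have h2 := energy_flow_succ_le S N x
    have h3 := frobSq_moment_flow_succ_le S N x
    rw [h N N.lt_succ_self] at h2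
    have h0 := energy_nonneg (repTuple S (flow S N x))
    have h4 : stepSize 1 (repTuple S x.1) ≤
        stepSize (1 : unitInterval) (repTuple S (flow S N x)) := by
      simp only [stepSize, unitInterval, Set.Icc.coe_one]
      have := energy_flow_le S N x
      gcongr
    have h5 : 0 ≤ stepSize 1 (repTuple S x.1) := stepSize_nonneg (1 : unitInterval) _
    have h6 := mul_le_mul_of_nonneg_right h4
      (frobSq_nonneg (moment (repTuple S (flow S N x))))
    have h7 := mul_le_mul_of_nonneg_left h3
      (mul_nonneg (Nat.cast_nonneg (α := ℝ) (N + 1)) h5)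
    push_cast at h7 ⊢
    linarith

theorem frobSq_moment_flow_le {N : ℕ} (hN : 1 ≤ N) {x : RepGL Γ n × unitInterval}
    (h : ∀ j, j < N → stepTime j x.2 = 1) :
    frobSq (moment (repTuple S (flow S N x))) ≤
      64 * energy (repTuple S x.1) * (1 + energy (repTuple S x.1)) / N := by
  have h1 := energy_flow_add_le S h
  have h0 := energy_nonneg (repTuple S (flow S N x))
  have he := energy_nonneg (repTuple S x.1)
  have hN' : (0 : ℝ) < N := by exact_mod_cast hN
  rw [le_div_iff₀ hN']
  have h2 : N * stepSize 1 (repTuple S x.1) * frobSq (moment (repTuple S (flow S N x))) ≤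
    energy (repTuple S x.1) := by linarith
  rw [stepSize, mul_one_div, div_mul_eq_mul_div, div_le_iff₀ (by positivity)] at h2
  linarith

theorem sqrt_frobSq_flow_sub_le_lyapunov {N M : ℕ} (hNM : N ≤ M) (x : RepGL Γ n × unitInterval)
    (i : S) : √(frobSq ((flow S M x).1 i - (flow S N x).1 i)) ≤
      4 * (√(orbitConst (Fin n)) + 1) *
        (lyapunov (repTuple S (flow S N x)) - lyapunov (repTuple S (flow S M x))) := by
  induction M, hNM using Nat.le_induction with
  | base => simp [frobSq, frobInner]
  | succ M _ ih =>
    have h := sqrt_frobSq_step_le_lyapunov_sub (repTuple S (flow S M x))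
      (stepSize_nonneg (stepTime M x.2) _) (stepSize_mul_energy_le _ _) i
    have h2 := sqrt_frobSq_sub_le ((flow S (M + 1) x).1 i) ((flow S M x).1 i) ((flow S N x).1 i)
    change √(frobSq ((flow S (M + 1) x).1 i - (flow S M x).1 i)) ≤ 4 * (√(orbitConst (Fin n)) + 1) *
      (lyapunov (repTuple S (flow S M x)) - lyapunov (repTuple S (flow S (M + 1) x))) at h
    linarith

theorem flow_eq_of_stepTime_eq_zero {N M : ℕ} (hNM : N ≤ M) {x : RepGL Γ n × unitInterval}
    (h : ∀ j, N ≤ j → stepTime j x.2 = 0) : flow S M x = flow S N x := by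
  induction M, hNM using Nat.le_induction with
  | base => rfl
  | succ M hM ih => rw [flow, h M hM, flowStep_zero, ih]

/-- The modulus of convergence of the discrete moment map flow. -/
noncomputable def flowModulus (N : ℕ) (x : RepGL Γ n × unitInterval) : ℝ :=
  4 * (√(orbitConst (Fin n)) + 1) * ((√(orbitConst (Fin n)) + 1) *
    √√(64 * energy (repTuple S x.1) * (1 + energy (repTuple S x.1)) / N))

theorem norm_flow_sub_le {N M : ℕ} (hN : 1 ≤ N) (hNM : N ≤ M) (x : RepGL Γ n × unitInterval)
    (i : S) (k j : Fin n) :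
    ‖(flow S M x).1 i k j - (flow S N x).1 i k j‖ ≤ flowModulus S N x := by
  have hD : 0 ≤ √(orbitConst (Fin n)) + 1 := by positivity
  have h0 : 0 ≤ flowModulus S N x := by unfold flowModulus; positivity
  rcases stepTime_eq_zero_or N x.2 with h | h
  · rw [flow_eq_of_stepTime_eq_zero S hNM h]
    simpa using h0
  · have h1 := norm_entry_sq_le_frobSq ((flow S M x).1 i - (flow S N x).1 i) k j
    have h2 := (Real.le_sqrt (norm_nonneg _) (frobSq_nonneg _)).2 h1
    rw [Matrix.sub_apply] at h2
    refine h2.trans ((sqrt_frobSq_flow_sub_le_lyapunov S hNM x i).trans ?_)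
    unfold flowModulus
    gcongr
    have h3 := lyapunov_nonneg (repTuple S (flow S M x))
    have h4 := lyapunov_le (repTuple S (flow S N x))
    have h5 := Real.sqrt_le_sqrt (Real.sqrt_le_sqrt (frobSq_moment_flow_le S hN h))
    have h6 := mul_le_mul_of_nonneg_left h5 hD
    linarith

end Flow

section JointLimit

open Filter Topology

theorem exists_tendsto_of_norm_sub_le {X E : Type*} [TopologicalSpace X] [NormedAddCommGroup E]
    [CompleteSpace E] {a : ℕ → X → E} {β : ℕ → X → ℝ} (ha : ∀ N, Continuous (a N))
    (h : ∀ N M x, 1 ≤ N → N ≤ M → ‖a M x - a N x‖ ≤ β N x) (x₀ : X)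
    (hβ : Tendsto (fun p : ℕ × X => β p.1 p.2) (atTop ×ˢ 𝓝 x₀) (𝓝 0)) :
    ∃ L, Tendsto (fun p : ℕ × X => a p.1 p.2) (atTop ×ˢ 𝓝 x₀) (𝓝 L) := by
  refine cauchy_map_iff_exists_tendsto.1 (Metric.cauchy_iff.2 ⟨inferInstance, fun ε hε => ?_⟩)
  have hev := (hβ.eventually (gt_mem_nhds (show 0 < ε / 6 by linarith))).curry
  obtain ⟨N, hN, hN1⟩ := (hev.and (eventually_ge_atTop 1)).exists
  have hc : ∀ᶠ x in 𝓝 x₀, dist (a N x) (a N x₀) < ε / 6 :=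
    (ha N).continuousAt.eventually (Metric.ball_mem_nhds _ (by linarith))
  have hmem := (eventually_ge_atTop N).prod_mk (hN.and hc)
  refine ⟨_, image_mem_map hmem, ?_⟩
  have key : ∀ p : ℕ × X, N ≤ p.1 ∧ β N p.2 < ε / 6 ∧ dist (a N p.2) (a N x₀) < ε / 6 →
      dist (a p.1 p.2) (a N x₀) < ε / 3 := fun p hp => by
    have h1 := h N p.1 p.2 hN1 hp.1
    rw [← dist_eq_norm] at h1
    linarith [dist_triangle (a p.1 p.2) (a N p.2) (a N x₀), hp.2.1, hp.2.2]
  rintro _ ⟨p, hp, rfl⟩ _ ⟨q, hq, rfl⟩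
  linarith [dist_triangle_right (a p.1 p.2) (a q.1 q.2) (a N x₀), key p hp, key q hq]

theorem tendsto_atTop_of_tendsto_prod {X Y : Type*} [TopologicalSpace X] {l : Filter Y}
    {a : ℕ → X → Y} {x : X}
    (h : Tendsto (fun p : ℕ × X => a p.1 p.2) (atTop ×ˢ 𝓝 x) l) :
    Tendsto (fun N => a N x) atTop l :=
  h.comp (tendsto_id.prodMk (tendsto_const_pure.mono_right (pure_le_nhds x)))

theorem continuous_of_tendsto_prod {X Y : Type*} [TopologicalSpace X] [TopologicalSpace Y]
    [RegularSpace Y] {a : ℕ → X → Y} {L : X → Y}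
    (h : ∀ x, Tendsto (fun p : ℕ × X => a p.1 p.2) (atTop ×ˢ 𝓝 x) (𝓝 (L x))) :
    Continuous L := by
  refine continuous_iff_continuousAt.2 fun x => ?_
  refine (closed_nhds_basis _).tendsto_right_iff.2 fun V hV => ?_
  obtain ⟨pa, hpa, pb, hpb, hab⟩ := eventually_prod_iff.1 ((h x).eventually hV.1)
  filter_upwards [hpb] with y hy
  exact hV.2.mem_of_tendsto (tendsto_atTop_of_tendsto_prod (h y))
    (hpa.mono fun N hN => hab hN hy)

end JointLimit

section FlowLimit

open Filter Topology

variable {Γ : Type} [Group Γ] {n : ℕ} (S : Finset Γ)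

theorem RepGL.inv_apply (ρ : RepGL Γ n) (γ : Γ) : ρ.1 γ⁻¹ = (ρ.1 γ)⁻¹ := by
  refine (inv_eq_left_inv ?_).symm
  rw [← ρ.2.2.1, inv_mul_cancel, ρ.2.1]

theorem tendsto_flowModulus (x : RepGL Γ n × unitInterval) :
    Tendsto (fun p : ℕ × (RepGL Γ n × unitInterval) => flowModulus S p.1 p.2)
      (atTop ×ˢ 𝓝 x) (𝓝 0) := by
  have h1 : Continuous fun y : RepGL Γ n × unitInterval => energy (repTuple S y.1) :=
    continuous_energy.comp ((continuous_repTuple S).comp continuous_fst)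
  have h2 : Continuous fun y : RepGL Γ n × unitInterval =>
      64 * energy (repTuple S y.1) * (1 + energy (repTuple S y.1)) := by fun_prop
  have h3 : Tendsto (fun p : ℕ × (RepGL Γ n × unitInterval) =>
      64 * energy (repTuple S p.2.1) * (1 + energy (repTuple S p.2.1)) / (p.1 : ℝ))
      (atTop ×ˢ 𝓝 x) (𝓝 0) := by
    have h4 := (h2.tendsto x).comp (tendsto_snd (f := (atTop : Filter ℕ)))
    have h5 := (tendsto_inv_atTop_nhds_zero_nat (𝕜 := ℝ)).comp
      (tendsto_fst (f := (atTop : Filter ℕ)) (g := 𝓝 x))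
    have h6 := h4.mul h5
    rw [mul_zero] at h6
    exact h6
  have h6 : Continuous fun r : ℝ => 4 * (√(orbitConst (Fin n)) + 1) *
      ((√(orbitConst (Fin n)) + 1) * √√r) := by fun_prop
  have h7 := (h6.tendsto 0).comp h3
  rw [Real.sqrt_zero, Real.sqrt_zero, mul_zero, mul_zero] at h7
  exact h7

theorem exists_tendsto_flow_of_mem (x : RepGL Γ n × unitInterval) {γ : Γ} (hγ : γ ∈ S) :
    ∃ L, Tendsto (fun p : ℕ × (RepGL Γ n × unitInterval) => (flow S p.1 p.2).1 γ)
      (atTop ×ˢ 𝓝 x) (𝓝 L) := by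
  have h : ∀ k j : Fin n, ∃ L, Tendsto
      (fun p : ℕ × (RepGL Γ n × unitInterval) => (flow S p.1 p.2).1 γ k j)
      (atTop ×ˢ 𝓝 x) (𝓝 L) := fun k j => by
    refine exists_tendsto_of_norm_sub_le (a := fun N y => (flow S N y).1 γ k j)
      (β := flowModulus S) (fun N => ?_)
      (fun N M y hN hNM => norm_flow_sub_le S hN hNM y ⟨γ, hγ⟩ k j) x (tendsto_flowModulus S x)
    exact ((continuous_repTuple_apply γ).comp (continuous_flow S N)).matrix_elem k j
  choose L hL using h
  exact ⟨L, tendsto_pi_nhds.2 fun k => tendsto_pi_nhds.2 fun j => hL k j⟩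

theorem det_of_tendsto_flow {x : RepGL Γ n × unitInterval} {γ : Γ}
    {L : Matrix (Fin n) (Fin n) ℂ}
    (hL : Tendsto (fun p : ℕ × (RepGL Γ n × unitInterval) => (flow S p.1 p.2).1 γ)
      (atTop ×ˢ 𝓝 x) (𝓝 L)) : L.det = (x.1.1 γ).det := by
  have h1 := ((continuous_id.matrix_det).tendsto L).comp
    (tendsto_atTop_of_tendsto_prod (a := fun N y => (flow S N y).1 γ) hL)
  refine tendsto_nhds_unique h1 (tendsto_const_nhds.congr fun N => ?_)
  exact (det_flow S N x γ).symm

theorem isUnit_of_tendsto_flow {x : RepGL Γ n × unitInterval} {γ : Γ}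
    {L : Matrix (Fin n) (Fin n) ℂ}
    (hL : Tendsto (fun p : ℕ × (RepGL Γ n × unitInterval) => (flow S p.1 p.2).1 γ)
      (atTop ×ˢ 𝓝 x) (𝓝 L)) : IsUnit L := by
  rw [isUnit_iff_isUnit_det, det_of_tendsto_flow S hL, ← isUnit_iff_isUnit_det]
  exact x.1.2.2.2 γ

theorem exists_tendsto_flow (hS : Subgroup.closure (S : Set Γ) = ⊤)
    (x : RepGL Γ n × unitInterval) (γ : Γ) :
    ∃ L, Tendsto (fun p : ℕ × (RepGL Γ n × unitInterval) => (flow S p.1 p.2).1 γ)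
      (atTop ×ˢ 𝓝 x) (𝓝 L) := by
  have hγ : γ ∈ Subgroup.closure (S : Set Γ) := hS ▸ Subgroup.mem_top γ
  induction hγ using Subgroup.closure_induction with
  | mem γ hγ => exact exists_tendsto_flow_of_mem S x hγ
  | one => exact ⟨1, tendsto_const_nhds.congr fun p => ((flow S p.1 p.2).2.1).symm⟩
  | mul a b _ _ iha ihb =>
    obtain ⟨La, hLa⟩ := iha
    obtain ⟨Lb, hLb⟩ := ihb
    exact ⟨La * Lb, (hLa.mul hLb).congr fun p => ((flow S p.1 p.2).2.2.1 a b).symm⟩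
  | inv a _ iha =>
    obtain ⟨La, hLa⟩ := iha
    refine ⟨La⁻¹, Tendsto.congr (fun p => ((flow S p.1 p.2).inv_apply a).symm) ?_⟩
    exact (continuousAt_inv_matrix (isUnit_of_tendsto_flow S hLa)).tendsto.comp hLa

theorem exists_flow_limit (hS : Subgroup.closure (S : Set Γ) = ⊤) :
    ∃ F : RepGL Γ n × unitInterval → RepGL Γ n, ∀ x γ,
      Tendsto (fun p : ℕ × (RepGL Γ n × unitInterval) => (flow S p.1 p.2).1 γ)
        (atTop ×ˢ 𝓝 x) (𝓝 ((F x).1 γ)) := by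
  choose L hL using exists_tendsto_flow (n := n) S hS
  refine ⟨fun x => ⟨L x, ?_, fun a b => ?_, fun γ => isUnit_of_tendsto_flow S (hL x γ)⟩, hL⟩
  · exact tendsto_nhds_unique (hL x 1)
      (tendsto_const_nhds.congr fun p => ((flow S p.1 p.2).2.1).symm)
  · exact tendsto_nhds_unique (hL x (a * b)) (((hL x a).mul (hL x b)).congr
      fun p => ((flow S p.1 p.2).2.2.1 a b).symm)

/-- The limit of the moment map flow deforms the representation space, equivariantly, into the
zero locus of the moment map. -/
theorem exists_deformation_moment_eq_zero (hS : Subgroup.closure (S : Set Γ) = ⊤) :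
    ∃ F : RepGL Γ n × unitInterval → RepGL Γ n, Continuous F ∧ (∀ ρ, F (ρ, 0) = ρ) ∧
      (∀ ρ, moment (repTuple S (F (ρ, 1))) = 0) ∧
      (∀ ρ, moment (repTuple S ρ) = 0 → ∀ t, F (ρ, t) = ρ) ∧
      ∀ U ∈ unitaryGroup (Fin n) ℂ, ∀ ρ σ : RepGL Γ n, UnitaryConj U ρ σ →
        ∀ t, UnitaryConj U (F (ρ, t)) (F (σ, t)) := by
  obtain ⟨F, hF⟩ := exists_flow_limit (n := n) S hS
  have hF' : ∀ x γ, Tendsto (fun N => (flow S N x).1 γ) atTop (𝓝 ((F x).1 γ)) :=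
    fun x γ => tendsto_atTop_of_tendsto_prod (a := fun N y => (flow S N y).1 γ) (hF x γ)
  have : RegularSpace (Matrix (Fin n) (Fin n) ℂ) :=
    inferInstanceAs (RegularSpace (Fin n → Fin n → ℂ))
  refine ⟨F, ?_, fun ρ => ?_, fun ρ => ?_, fun ρ h t => ?_, fun U hU ρ σ h t γ => ?_⟩
  · exact Continuous.subtype_mk (continuous_pi fun γ =>
      continuous_of_tendsto_prod (a := fun N x => (flow S N x).1 γ) fun x => hF x γ) _
  · refine Subtype.ext (funext fun γ => tendsto_nhds_unique (hF' _ γ) ?_)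
    exact tendsto_const_nhds.congr fun N => by rw [flow_time_zero]
  · have h1 : Tendsto (fun N => repTuple S (flow S N (ρ, 1))) atTop
        (𝓝 (repTuple S (F (ρ, 1)))) := tendsto_pi_nhds.2 fun i => hF' (ρ, 1) i
    have h2 := ((continuous_frobSq.comp continuous_moment).tendsto _).comp h1
    have h3 : Tendsto (fun N : ℕ => 64 * energy (repTuple S ρ) * (1 + energy (repTuple S ρ)) / N)
        atTop (𝓝 (0 : ℝ)) := tendsto_const_div_atTop_nhds_zero_nat _
    refine frobSq_eq_zero_iff.1 (le_antisymm (le_of_tendsto_of_tendsto h2 h3 ?_)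
      (frobSq_nonneg _))
    filter_upwards [eventually_ge_atTop 1] with N hN
    exact frobSq_moment_flow_le S hN (x := (ρ, 1)) fun j _ => stepTime_one j
  · refine Subtype.ext (funext fun γ => tendsto_nhds_unique (hF' _ γ) ?_)
    exact tendsto_const_nhds.congr fun N => by rw [flow_of_moment_eq_zero S N h]
  · refine tendsto_nhds_unique (hF' (σ, t) γ) (Tendsto.congr
      (fun N => (UnitaryConj.flow S hU h t N γ).symm) ?_)
    exact ((hF' (ρ, t) γ).const_mul U).mul_const (star U)

end FlowLimit

section Commutator

open scoped commutatorElement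

variable {Γ : Type} [Group Γ] {n : ℕ}

open scoped ComplexOrder in
theorem RepGL.posDef (ρ : RepGL Γ n) (γ : Γ) : ((ρ.1 γ)ᴴ * ρ.1 γ).PosDef :=
  PosDef.conjTranspose_mul_self _ (mulVec_injective_of_isUnit (ρ.2.2.2 γ))

theorem det_multiplicative_eq_one {R : Type*} [CommRing R] {m : Type*} [Fintype m]
    [DecidableEq m] {g : Γ → Matrix m m R} (h1 : g 1 = 1) (hm : ∀ a b, g (a * b) = g a * g b)
    (a b : Γ) : (g ⁅a, b⁆).det = 1 := by
  have h : ∀ γ, (g γ).det * (g γ⁻¹).det = 1 := fun γ => by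
    rw [← det_mul, ← hm, mul_inv_cancel, h1, det_one]
  rw [commutatorElement_def, hm, hm, hm, det_mul, det_mul, det_mul]
  linear_combination (g b).det * (g b⁻¹).det * h a + h b

theorem compress_mul_compress {R : Type*} [Ring R] {e X Y : R} (he : e * e = e)
    (hX : e * X = X * e) :
    (e * X + (1 - e)) * (e * Y + (1 - e)) = e * (X * Y) + (1 - e) := by
  have h1 : e * (1 - e) = 0 := by rw [mul_sub, mul_one, he, sub_self]
  have h2 : (1 - e) * e = 0 := by rw [sub_mul, one_mul, he, sub_self]
  have h3 : (1 - e) * (1 - e) = 1 - e := by rw [mul_sub, mul_one, h2, sub_zero]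
  rw [mul_add, add_mul, add_mul, h3, ← mul_assoc (1 - e), h2, zero_mul, add_zero, hX,
    mul_assoc X e (1 - e), h1, mul_zero, zero_add, ← mul_assoc, mul_assoc X, he, ← hX, mul_assoc]

theorem realDiag_eq_one_of_commutator {g : Γ → Matrix (Fin n) (Fin n) ℂ} (h1 : g 1 = 1)
    (hm : ∀ a b, g (a * b) = g a * g b) {d : Fin n → ℝ} (hd : ∀ k, 0 < d k) (a b : Γ)
    (hz : (g ⁅a, b⁆)ᴴ * g ⁅a, b⁆ = realDiag d) (hc : ∀ γ, Commute (realDiag d) (g γ)) :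
    realDiag d = 1 := by
  suffices h : ∀ k, d k = 1 by rw [show d = fun _ => 1 from funext h, realDiag_one]
  intro k₀
  set e : Matrix (Fin n) (Fin n) ℂ := realDiag fun k => if d k = d k₀ then 1 else 0 with he_def
  have he : e * e = e := by
    rw [he_def, realDiag_mul]
    congr 1
    funext k
    split_ifs <;> simp
  have hec : ∀ γ, e * g γ = g γ * e := fun γ => by
    ext k j
    have h := congrFun (congrFun (hc γ).eq k) j
    simp only [he_def, realDiag, diagonal_mul, mul_diagonal] at h ⊢
    have h' : ((d k : ℂ) - d j) * g γ k j = 0 := by linear_combination h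
    rcases mul_eq_zero.1 h' with h0 | h0
    · rw [show d k = d j by exact_mod_cast sub_eq_zero.1 h0, mul_comm]
    · rw [h0, mul_zero, zero_mul]
  set z := g ⁅a, b⁆ with hz_def
  have hdet : (e * z + (1 - e)).det = 1 := by
    refine det_multiplicative_eq_one (g := fun γ => e * g γ + (1 - e)) ?_ (fun x y => ?_) a b
    · simp [h1]
    · rw [compress_mul_compress he (hec x), hm]
  have heH : eᴴ = e := realDiag_conjTranspose _
  have hzH : e * zᴴ = zᴴ * e := by
    have := congrArg conjTranspose (hec ⁅a, b⁆)
    rw [conjTranspose_mul, conjTranspose_mul, heH] at this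
    exact this.symm
  have hprod : (e * z + (1 - e))ᴴ * (e * z + (1 - e)) =
      realDiag fun k => if d k = d k₀ then d k₀ else 1 := by
    rw [conjTranspose_add, conjTranspose_mul, conjTranspose_sub, conjTranspose_one, heH, ← hzH,
      compress_mul_compress he hzH, hz, ← realDiag_one, he_def, realDiag_mul]
    ext k j
    simp only [realDiag, Matrix.add_apply, Matrix.sub_apply, diagonal_apply]
    split_ifs with h2 h3 <;> simp_all
  have hd1 := congrArg det hprod
  rw [det_mul, det_conjTranspose, hdet, star_one, mul_one, realDiag, det_diagonal,
    ← Complex.ofReal_prod, Finset.prod_ite, Finset.prod_const, Finset.prod_const_one,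
    mul_one] at hd1
  have hd2 : d k₀ ^ (Finset.univ.filter fun k => d k = d k₀).card = 1 := by
    exact_mod_cast hd1.symm
  refine (pow_eq_one_iff_of_nonneg (hd k₀).le (Finset.card_pos.2 ⟨k₀, ?_⟩).ne').1 hd2
  simp

open scoped ComplexOrder in
theorem RepGL.unitary_of_commutator (ρ : RepGL Γ n) (a b : Γ)
    (hc : ∀ γ, Commute ((ρ.1 ⁅a, b⁆)ᴴ * ρ.1 ⁅a, b⁆) (ρ.1 γ)) :
    ρ.1 ⁅a, b⁆ ∈ unitaryGroup (Fin n) ℂ := by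
  obtain ⟨U, hU, d, hd, hP⟩ := posDef_eq_unitary_conj_realDiag (ρ.posDef ⁅a, b⁆)
  have hU1 : U * Uᴴ = 1 := mem_unitaryGroup_iff.1 hU
  have hU2 : Uᴴ * U = 1 := mem_unitaryGroup_iff'.1 hU
  have hD : realDiag d = Uᴴ * ((ρ.1 ⁅a, b⁆)ᴴ * ρ.1 ⁅a, b⁆) * U := by
    rw [hP, show Uᴴ * (U * realDiag d * Uᴴ) * U = (Uᴴ * U) * realDiag d * (Uᴴ * U) by
      simp only [mul_assoc], hU2, one_mul, mul_one]
  have hconj : ∀ X Y : Matrix (Fin n) (Fin n) ℂ,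
      Uᴴ * X * U * (Uᴴ * Y * U) = Uᴴ * (X * Y) * U := fun X Y => by
    rw [show Uᴴ * X * U * (Uᴴ * Y * U) = Uᴴ * X * (U * Uᴴ) * Y * U by simp only [mul_assoc],
      hU1, mul_one]
    simp only [mul_assoc]
  have h := realDiag_eq_one_of_commutator (g := fun γ => Uᴴ * ρ.1 γ * U) (d := d)
    (by rw [ρ.2.1, mul_one, hU2]) (fun x y => by rw [ρ.2.2.1, hconj]) hd a b
    (by rw [conjTranspose_mul, conjTranspose_mul, conjTranspose_conjTranspose, ← mul_assoc Uᴴ,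
          hconj, hD])
    (fun γ => by
      change realDiag d * (Uᴴ * ρ.1 γ * U) = Uᴴ * ρ.1 γ * U * realDiag d
      rw [hD, hconj, hconj, (hc γ).eq])
  rw [h, mul_one, hU1] at hP
  exact mem_unitaryGroup_iff'.2 hP

theorem RepGL.commute_of_closure (ρ : RepGL Γ n) {S : Set Γ} (hS : Subgroup.closure S = ⊤)
    {P : Matrix (Fin n) (Fin n) ℂ} (h : ∀ γ ∈ S, Commute P (ρ.1 γ)) (γ : Γ) :
    Commute P (ρ.1 γ) := by
  have hγ : γ ∈ Subgroup.closure S := hS ▸ Subgroup.mem_top γ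
  induction hγ using Subgroup.closure_induction with
  | mem γ hγ => exact h γ hγ
  | one => rw [ρ.2.1]; exact Commute.one_right P
  | mul a b _ _ iha ihb => rw [ρ.2.2.1]; exact iha.mul_right ihb
  | inv a _ iha =>
    have h1 : ρ.1 a⁻¹ * ρ.1 a = 1 := by rw [← ρ.2.2.1, inv_mul_cancel, ρ.2.1]
    have h2 : ρ.1 a * ρ.1 a⁻¹ = 1 := by rw [← ρ.2.2.1, mul_inv_cancel, ρ.2.1]
    calc P * ρ.1 a⁻¹ = ρ.1 a⁻¹ * (ρ.1 a * P) * ρ.1 a⁻¹ := by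
          rw [← mul_assoc, h1, one_mul]
      _ = ρ.1 a⁻¹ * P := by rw [← iha.eq, mul_assoc, mul_assoc, h2, mul_one]

theorem RepGL.commute_of_mem_upperCentralSeries (ρ : RepGL Γ n) {S : Finset Γ}
    (hS : Subgroup.closure (S : Set Γ) = ⊤) (hρ : moment (repTuple S ρ) = 0) (i : ℕ) :
    ∀ g ∈ Subgroup.upperCentralSeries Γ i, ∀ γ, Commute ((ρ.1 g)ᴴ * ρ.1 g) (ρ.1 γ) := by
  induction i with
  | zero =>
    intro g hg γ
    rw [Subgroup.upperCentralSeries_zero, Subgroup.mem_bot] at hg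
    rw [hg, ρ.2.1, conjTranspose_one, mul_one]
    exact Commute.one_left _
  | succ i ih =>
    intro g hg
    rw [Subgroup.mem_upperCentralSeries_succ_iff] at hg
    refine ρ.commute_of_closure hS fun γ hγ => ?_
    refine commute_conjTranspose_mul_self_of_energy_eq hρ (ρ.2.2.2 g) ?_ ⟨γ, hγ⟩
    refine Finset.sum_congr rfl fun s _ => ?_
    have h : conjTuple (ρ.1 g) (repTuple S ρ) s = ρ.1 ⁅g, (s : Γ)⁆ * ρ.1 s := by
      change ρ.1 g * ρ.1 s * (ρ.1 g)⁻¹ = _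
      rw [← ρ.inv_apply, ← ρ.2.2.1, ← ρ.2.2.1, ← ρ.2.2.1, commutatorElement_def,
        inv_mul_cancel_right]
    rw [h, frobSq_unitary_mul (ρ.unitary_of_commutator _ _ (ih _ (hg s)))]
    rfl

theorem RepGL.commute_of_moment_eq_zero [Group.IsNilpotent Γ] (ρ : RepGL Γ n) {S : Finset Γ}
    (hS : Subgroup.closure (S : Set Γ) = ⊤) (hρ : moment (repTuple S ρ) = 0) (g γ : Γ) :
    Commute ((ρ.1 g)ᴴ * ρ.1 g) (ρ.1 γ) := by
  obtain ⟨i, hi⟩ := Group.IsNilpotent.nilpotent Γ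
  exact ρ.commute_of_mem_upperCentralSeries hS hρ i g (hi ▸ Subgroup.mem_top g) γ

end Commutator

section PolarFactor

open scoped ComplexOrder MatrixOrder Matrix.Norms.L2Operator
open NormedSpace

variable {n : ℕ}

/-- The power `P ^ (-t / 2)` of a positive definite matrix `P`. -/
noncomputable def polarFactor (t : ℝ) (P : Matrix (Fin n) (Fin n) ℂ) :
    Matrix (Fin n) (Fin n) ℂ := exp ((-(t / 2)) • CFC.log P)

theorem exp_log_of_posDef {P : Matrix (Fin n) (Fin n) ℂ} (hP : P.PosDef) :
    exp (CFC.log P) = P := CFC.exp_log P hP.isStrictlyPositive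

theorem continuousOn_polarFactor :
    ContinuousOn (fun x : ℝ × Matrix (Fin n) (Fin n) ℂ => polarFactor x.1 x.2)
      {x | x.2.PosDef} := by
  have h1 : ContinuousOn (fun x : ℝ × Matrix (Fin n) (Fin n) ℂ => CFC.log x.2)
      {x | x.2.PosDef} :=
    CFC.continuousOn_log.comp continuousOn_snd fun x hx => ⟨hx.1, hx.isUnit⟩
  have h2 : Continuous fun x : ℝ × Matrix (Fin n) (Fin n) ℂ => -(x.1 / 2) := by fun_prop
  let _ : NormedAlgebra ℚ (Matrix (Fin n) (Fin n) ℂ) := .restrictScalars ℚ ℂ _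
  exact exp_continuous.comp_continuousOn (h2.continuousOn.smul h1)

theorem commute_polarFactor {P B : Matrix (Fin n) (Fin n) ℂ} (h : Commute P B) (t : ℝ) :
    Commute (polarFactor t P) B :=
  ((h.cfc_real Real.log).smul_left _).exp_left

theorem log_mul_of_commute {P Q : Matrix (Fin n) (Fin n) ℂ} (hP : P.PosDef) (hQ : Q.PosDef)
    (h : Commute P Q) : CFC.log (P * Q) = CFC.log P + CFC.log Q := by
  have hc : Commute (CFC.log P) (CFC.log Q) :=
    ((h.cfc_real Real.log).symm.cfc_real Real.log).symm
  conv_lhs => rw [← exp_log_of_posDef hP, ← exp_log_of_posDef hQ]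
  rw [← Matrix.exp_add_of_commute _ _ hc, CFC.log_exp _ (IsSelfAdjoint.log.add IsSelfAdjoint.log)]

theorem polarFactor_mul {P Q : Matrix (Fin n) (Fin n) ℂ} (hP : P.PosDef) (hQ : Q.PosDef)
    (h : Commute P Q) (t : ℝ) : polarFactor t (P * Q) = polarFactor t P * polarFactor t Q := by
  have hc : Commute (CFC.log P) (CFC.log Q) :=
    ((h.cfc_real Real.log).symm.cfc_real Real.log).symm
  rw [polarFactor, log_mul_of_commute hP hQ h, smul_add,
    Matrix.exp_add_of_commute _ _ ((hc.smul_left _).smul_right _), polarFactor, polarFactor]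

theorem polarFactor_zero (P : Matrix (Fin n) (Fin n) ℂ) : polarFactor 0 P = 1 := by
  simp [polarFactor]

theorem polarFactor_one_right (t : ℝ) : polarFactor t (1 : Matrix (Fin n) (Fin n) ℂ) = 1 := by
  simp [polarFactor]

theorem isUnit_polarFactor (t : ℝ) (P : Matrix (Fin n) (Fin n) ℂ) : IsUnit (polarFactor t P) :=
  Matrix.isUnit_exp _

theorem polarFactor_conjTranspose (t : ℝ) (P : Matrix (Fin n) (Fin n) ℂ) :
    (polarFactor t P)ᴴ = polarFactor t P := by
  rw [polarFactor, ← Matrix.exp_conjTranspose, conjTranspose_smul, star_trivial]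
  congr 2
  exact IsSelfAdjoint.log

theorem polarFactor_one_mul_self_mul {P : Matrix (Fin n) (Fin n) ℂ} (hP : P.PosDef) :
    polarFactor 1 P * P * polarFactor 1 P = 1 := by
  have h : polarFactor 1 P * polarFactor 1 P * exp (CFC.log P) = 1 := by
    rw [polarFactor, ← Matrix.exp_add_of_commute _ _ (Commute.refl _), ← add_smul,
      show -((1 : ℝ) / 2) + -(1 / 2) = -1 by norm_num, neg_one_smul,
      ← Matrix.exp_add_of_commute _ _ (Commute.refl (CFC.log P)).neg_left, neg_add_cancel, exp_zero]
  rw [exp_log_of_posDef hP] at h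
  rw [mul_assoc, ← (commute_polarFactor (Commute.refl P) 1).eq, ← mul_assoc, h]

theorem polarFactor_unitary_conj {U P : Matrix (Fin n) (Fin n) ℂ}
    (hU : U ∈ unitaryGroup (Fin n) ℂ) (hP : P.PosDef) (t : ℝ) :
    polarFactor t (U * P * Uᴴ) = U * polarFactor t P * Uᴴ := by
  have hUu : IsUnit U := (Unitary.toUnits ⟨U, hU⟩).isUnit
  have hlog : CFC.log (U * P * Uᴴ) = U * CFC.log P * Uᴴ := by
    conv_lhs => rw [← exp_log_of_posDef hP, ← inv_eq_conjTranspose_of_unitary hU,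
      ← Matrix.exp_conj _ _ hUu, inv_eq_conjTranspose_of_unitary hU]
    exact CFC.log_exp _ (IsSelfAdjoint.log.conjugate U)
  rw [polarFactor, hlog, ← smul_mul_assoc, ← mul_smul_comm, ← inv_eq_conjTranspose_of_unitary hU,
    Matrix.exp_conj _ _ hUu, polarFactor]

end PolarFactor

section PolarDeformation

variable {Γ : Type} [Group Γ] {n : ℕ}

/-- The squared absolute values of the matrices of a representation commute with it. -/
def CommutesAbs (ρ : RepGL Γ n) : Prop := ∀ g γ, Commute ((ρ.1 g)ᴴ * ρ.1 g) (ρ.1 γ)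

theorem CommutesAbs.commute {ρ : RepGL Γ n} (hρ : CommutesAbs ρ) (a b : Γ) :
    Commute ((ρ.1 a)ᴴ * ρ.1 a) ((ρ.1 b)ᴴ * ρ.1 b) := by
  refine Commute.mul_right ?_ (hρ a b)
  have h := congrArg conjTranspose (hρ a b).eq
  simp only [conjTranspose_mul, conjTranspose_conjTranspose] at h
  exact h.symm

theorem CommutesAbs.abs_mul {ρ : RepGL Γ n} (hρ : CommutesAbs ρ) (a b : Γ) :
    (ρ.1 (a * b))ᴴ * ρ.1 (a * b) = (ρ.1 a)ᴴ * ρ.1 a * ((ρ.1 b)ᴴ * ρ.1 b) := by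
  rw [(hρ.commute a b).eq, ρ.2.2.1, conjTranspose_mul, mul_assoc (ρ.1 b)ᴴ (ρ.1 b),
    ← (hρ a b).eq]
  simp only [mul_assoc]

/-- The deformation of a representation into a unitary one by powers of absolute values. -/
noncomputable def polarDeform (t : ℝ) (ρ : RepGL Γ n) (hρ : CommutesAbs ρ) : RepGL Γ n :=
  ⟨fun γ => ρ.1 γ * polarFactor t ((ρ.1 γ)ᴴ * ρ.1 γ), by
    refine ⟨?_, fun a b => ?_, fun γ => (ρ.2.2.2 γ).mul (isUnit_polarFactor _ _)⟩
    · beta_reduce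
      rw [ρ.2.1, conjTranspose_one, mul_one, polarFactor_one_right, mul_one]
    · beta_reduce
      rw [hρ.abs_mul, polarFactor_mul (ρ.posDef a) (ρ.posDef b) (hρ.commute a b), ρ.2.2.1,
        mul_assoc (ρ.1 a), ← mul_assoc (ρ.1 b), ← (commute_polarFactor (hρ a b) t).eq]
      simp only [mul_assoc]⟩

theorem polarDeform_zero (ρ : RepGL Γ n) (hρ : CommutesAbs ρ) : polarDeform 0 ρ hρ = ρ :=
  Subtype.ext (funext fun γ => by simp [polarDeform, polarFactor_zero])

theorem polarDeform_of_unitary (t : ℝ) {ρ : RepGL Γ n} (hρ : CommutesAbs ρ)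
    (h : ∀ γ, ρ.1 γ ∈ unitaryGroup (Fin n) ℂ) : polarDeform t ρ hρ = ρ := by
  refine Subtype.ext (funext fun γ => ?_)
  have h1 : (ρ.1 γ)ᴴ * ρ.1 γ = 1 := mem_unitaryGroup_iff'.1 (h γ)
  simp [polarDeform, h1, polarFactor_one_right]

theorem polarDeform_one_mem_unitaryGroup (ρ : RepGL Γ n) (hρ : CommutesAbs ρ) (γ : Γ) :
    (polarDeform 1 ρ hρ).1 γ ∈ unitaryGroup (Fin n) ℂ := by
  refine mem_unitaryGroup_iff'.2 ?_
  have h := polarFactor_one_mul_self_mul (ρ.posDef γ)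
  change (ρ.1 γ * polarFactor 1 ((ρ.1 γ)ᴴ * ρ.1 γ))ᴴ *
    (ρ.1 γ * polarFactor 1 ((ρ.1 γ)ᴴ * ρ.1 γ)) = 1
  rw [conjTranspose_mul, polarFactor_conjTranspose, ← mul_assoc, mul_assoc _ (ρ.1 γ)ᴴ, h]

theorem UnitaryConj.polarDeform {U : Matrix (Fin n) (Fin n) ℂ}
    (hU : U ∈ unitaryGroup (Fin n) ℂ) {ρ σ : RepGL Γ n} (h : UnitaryConj U ρ σ) (t : ℝ)
    (hρ : CommutesAbs ρ) (hσ : CommutesAbs σ) :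
    UnitaryConj U (polarDeform t ρ hρ) (polarDeform t σ hσ) := by
  intro γ
  have hU2 : Uᴴ * U = 1 := mem_unitaryGroup_iff'.1 hU
  have h1 : σ.1 γ = U * ρ.1 γ * Uᴴ := h γ
  have h2 : (σ.1 γ)ᴴ * σ.1 γ = U * ((ρ.1 γ)ᴴ * ρ.1 γ) * Uᴴ := by
    rw [h1, conjTranspose_mul, conjTranspose_mul, conjTranspose_conjTranspose,
      show U * ((ρ.1 γ)ᴴ * Uᴴ) * (U * ρ.1 γ * Uᴴ) = U * (ρ.1 γ)ᴴ * (Uᴴ * U) * ρ.1 γ * Uᴴ by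
        simp only [mul_assoc], hU2, mul_one, mul_assoc U]
  change σ.1 γ * polarFactor t ((σ.1 γ)ᴴ * σ.1 γ) =
    U * (ρ.1 γ * polarFactor t ((ρ.1 γ)ᴴ * ρ.1 γ)) * Uᴴ
  rw [h2, polarFactor_unitary_conj hU (ρ.posDef γ), h1, ← mul_assoc, ← mul_assoc,
    mul_assoc (U * ρ.1 γ), hU2, mul_one, ← mul_assoc]

theorem continuous_polarDeform {X : Type*} [TopologicalSpace X] {t : X → ℝ} {ρ : X → RepGL Γ n}
    (ht : Continuous t) (hρ : Continuous ρ) (h : ∀ x, CommutesAbs (ρ x)) :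
    Continuous fun x => polarDeform (t x) (ρ x) (h x) := by
  refine Continuous.subtype_mk (continuous_pi fun γ => ?_) _
  have h1 : Continuous fun x => (ρ x).1 γ := (continuous_repTuple_apply γ).comp hρ
  have h2 : Continuous fun x => (t x, ((ρ x).1 γ)ᴴ * (ρ x).1 γ) :=
    ht.prodMk (h1.matrix_conjTranspose.mul h1)
  exact h1.mul (continuousOn_polarFactor.comp_continuous h2 fun x => (ρ x).posDef γ)

theorem moment_repTuple_of_unitary (S : Finset Γ) {ρ : RepGL Γ n}
    (h : ∀ γ, ρ.1 γ ∈ unitaryGroup (Fin n) ℂ) : moment (repTuple S ρ) = 0 := by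
  refine Finset.sum_eq_zero fun i _ => ?_
  have h1 : ρ.1 i * (ρ.1 i)ᴴ = 1 := mem_unitaryGroup_iff.1 (h i)
  have h2 : (ρ.1 i)ᴴ * ρ.1 i = 1 := mem_unitaryGroup_iff'.1 (h i)
  simp [repTuple, h1, h2]

end PolarDeformation

/-- Theorem I of the paper in the complex case, for `G = GL_n ℂ` and `K = U(n)`:
for a finitely generated nilpotent group `Γ`, there is a `U(n)`-equivariant strong
deformation retraction of `Hom(Γ, GL_n ℂ)` onto `Hom(Γ, U(n))`. -/
theorem theoremI_complex_GL (Γ : Type) [Group Γ] [Group.FG Γ] [Group.IsNilpotent Γ]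
    (n : ℕ) (hn : 1 ≤ n) :
    ∃ H : RepGL Γ n × unitInterval → RepGL Γ n,
      Continuous H ∧
      (∀ x, H (x, 0) = x) ∧
      (∀ x γ, (H (x, 1)).1 γ ∈ Matrix.unitaryGroup (Fin n) ℂ) ∧
      (∀ a : RepGL Γ n, (∀ γ, a.1 γ ∈ Matrix.unitaryGroup (Fin n) ℂ) →
        ∀ t, H (a, t) = a) ∧
      (∀ u : Matrix.unitaryGroup (Fin n) ℂ, ∀ ρ σ : RepGL Γ n,
        (∀ γ, σ.1 γ =
            (u : Matrix (Fin n) (Fin n) ℂ) * ρ.1 γ * star (u : Matrix (Fin n) (Fin n) ℂ)) →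
        ∀ t γ, (H (σ, t)).1 γ =
            (u : Matrix (Fin n) (Fin n) ℂ) * (H (ρ, t)).1 γ *
              star (u : Matrix (Fin n) (Fin n) ℂ)) := by
  obtain ⟨S, hS⟩ := Group.FG.out (G := Γ)
  obtain ⟨F, hF, hF0, hF1, hFfix, hFconj⟩ := exists_deformation_moment_eq_zero (n := n) S hS
  have hc : ∀ ρ, CommutesAbs (F (ρ, 1)) := fun ρ =>
    (F (ρ, 1)).commute_of_moment_eq_zero hS (hF1 ρ)
  let τ : unitInterval → unitInterval := fun t => Set.projIcc (0 : ℝ) 1 zero_le_one (2 * t)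
  have hτ : Continuous τ := continuous_projIcc.comp (continuous_const.mul continuous_subtype_val)
  have hF' : Continuous fun x : RepGL Γ n × unitInterval => F (x.1, τ x.2) :=
    hF.comp (continuous_fst.prodMk (hτ.comp continuous_snd))
  have hF1' : Continuous fun x : RepGL Γ n × unitInterval => F (x.1, 1) :=
    hF.comp (continuous_fst.prodMk continuous_const)
  have ht : Continuous fun x : RepGL Γ n × unitInterval => 2 * (x.2 : ℝ) - 1 := by fun_prop
  have hP : Continuous fun x : RepGL Γ n × unitInterval =>
      polarDeform (2 * (x.2 : ℝ) - 1) (F (x.1, 1)) (hc x.1) :=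
    continuous_polarDeform ht hF1' fun x => hc x.1
  refine ⟨fun x => if (x.2 : ℝ) ≤ 1 / 2 then F (x.1, τ x.2) else
    polarDeform (2 * x.2 - 1) (F (x.1, 1)) (hc x.1), ?_, fun ρ => ?_, fun ρ γ => ?_,
    fun a ha t => ?_, fun u ρ σ h t => ?_⟩
  · refine hF'.if_le hP (continuous_subtype_val.comp continuous_snd) continuous_const fun x hx => ?_
    have h1 : τ x.2 = 1 := Set.projIcc_of_right_le _ (by rw [hx]; norm_num)
    have h2 : 2 * (x.2 : ℝ) - 1 = 0 := by rw [hx]; norm_num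
    simp only [h1, h2, polarDeform_zero]
  · have h1 : τ 0 = 0 := Set.projIcc_of_le_left _ (by simp)
    simp [h1, hF0]
  · have h1 : ¬ (((1 : unitInterval) : ℝ) ≤ 1 / 2) := by norm_num
    have h2 : 2 * ((1 : unitInterval) : ℝ) - 1 = 1 := by norm_num
    simp only [h1, if_false, h2]
    exact polarDeform_one_mem_unitaryGroup _ _ γ
  · have h1 := hFfix a (moment_repTuple_of_unitary S ha)
    dsimp only
    split_ifs
    · exact h1 _
    · rw [polarDeform_of_unitary _ _ (by rw [h1]; exact ha), h1]
  · dsimp only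
    split_ifs
    · exact hFconj u u.2 ρ σ h _
    · exact UnitaryConj.polarDeform u.2 (hFconj u u.2 ρ σ h 1) _ _ _
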